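/- arXiv:1410.8272 — 3 statements merged into one kernel-verified Lean document; each statement's English description precedes it below -/
import Mathlib

section
/- Let P ⊆ ℝ² be a lattice 2-polytope (a lattice polygon) such that the topological interior of P contains exactly one point of ℤ². Then P is Gorenstein, i.e. it is Gorenstein at every vertex. -/
open Set Pointwise

noncomputable section

/-- The set of lattice points of `ℝⁿ`: points with all coordinates integers. -/
def lat (n : ℕ) : Set (Fin n → ℝ) := {x | ∀ i, ∃ z : ℤ, x i = (z : ℝ)}

/-- The dilate `kP` of a subset `P ⊆ ℝⁿ`. -/
def dilate (n k : ℕ) (P : Set (Fin n → ℝ)) : Set (Fin n → ℝ) :=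
  (fun x => (k : ℝ) • x) '' P

/-- A lattice `n`-polytope: the convex hull of finitely many lattice points,
whose affine hull is all of `ℝⁿ`. -/
def IsLatticePolytope (n : ℕ) (P : Set (Fin n → ℝ)) : Prop :=
  (∃ S : Finset (Fin n → ℤ), S.Nonempty ∧
    P = convexHull ℝ ((fun m : Fin n → ℤ => fun i => (m i : ℝ)) '' (S : Set (Fin n → ℤ)))) ∧
  affineSpan ℝ P = ⊤

/-- The cone of `P` at a point `v`: `C_v(P) = {r • (x - v) : r ≥ 0, x ∈ P}`. -/
def coneAt (n : ℕ) (P : Set (Fin n → ℝ)) (v : Fin n → ℝ) : Set (Fin n → ℝ) :=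
  {y | ∃ r : ℝ, 0 ≤ r ∧ ∃ x ∈ P, y = r • (x - v)}

/-- `P` is Gorenstein at `v`: there is a lattice point `m₀` in `C_v(P)` with
`Int(C_v(P)) ∩ ℤⁿ = m₀ + (C_v(P) ∩ ℤⁿ)`. -/
def GorensteinAt (n : ℕ) (P : Set (Fin n → ℝ)) (v : Fin n → ℝ) : Prop :=
  ∃ m₀ ∈ coneAt n P v ∩ lat n,
    interior (coneAt n P v) ∩ lat n = (fun y => m₀ + y) '' (coneAt n P v ∩ lat n)

/-- `P` is Gorenstein: it is Gorenstein at every vertex (extreme point). -/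
def Gorenstein (n : ℕ) (P : Set (Fin n → ℝ)) : Prop :=
  ∀ v ∈ Set.extremePoints ℝ P, GorensteinAt n P v

/-- `F` is a facet of the `n`-polytope `P`: a face (extreme subset) of dimension `n-1`. -/
def IsFacet (n : ℕ) (P F : Set (Fin n → ℝ)) : Prop :=
  IsExtreme ℝ P F ∧ Module.finrank ℝ (affineSpan ℝ F).direction = n - 1

/-- `P` is a pyramid: there are a facet `F` and a vertex `v ∉ F` with `P = Conv(F ∪ {v})`. -/
def IsPyramid (n : ℕ) (P : Set (Fin n → ℝ)) : Prop :=
  ∃ F v, IsFacet n P F ∧ v ∈ Set.extremePoints ℝ P ∧ v ∉ F ∧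
    P = convexHull ℝ (F ∪ {v})

/-- The simplex `D_n = Conv{0, e₁, e₂, e₁+e₂+2e₃, e₄, …, eₙ}` (standard basis `e₁, …, eₙ`,
so `eᵢ = Pi.single i⁻¹` with 0-based indices; the points `Pi.single i 1` for `(i : ℕ) ≠ 2`
are `e₁, e₂, e₄, …, eₙ`, and the last listed point is `e₁ + e₂ + 2e₃`). -/
def Dn (n : ℕ) : Set (Fin n → ℝ) :=
  convexHull ℝ ({0} ∪ {x | ∃ i : Fin n, (i : ℕ) ≠ 2 ∧ x = Pi.single i (1 : ℝ)} ∪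
    {fun j : Fin n => if (j : ℕ) = 0 ∨ (j : ℕ) = 1 then (1 : ℝ) else
      if (j : ℕ) = 2 then 2 else 0})

/-- The affine map `x ↦ A·x + b` of `ℝⁿ` given by an integral matrix `A` and `b ∈ ℤⁿ`. -/
def unimodularMap (n : ℕ) (A : Matrix (Fin n) (Fin n) ℤ) (b : Fin n → ℤ) :
    (Fin n → ℝ) → (Fin n → ℝ) :=
  fun x => (A.map (Int.cast : ℤ → ℝ)).mulVec x + fun i => (b i : ℝ)

/-- The basic simplex `Conv{0, e₁, …, eₙ}`. -/
def basicSimplex (n : ℕ) : Set (Fin n → ℝ) :=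
  convexHull ℝ ({0} ∪ Set.range fun i : Fin n => (Pi.single i (1 : ℝ) : Fin n → ℝ))

/-- A ray (one-dimensional face) of a cone `C`. -/
def IsRay (n : ℕ) (C ρ : Set (Fin n → ℝ)) : Prop :=
  IsExtreme ℝ C ρ ∧ Module.finrank ℝ (Submodule.span ℝ ρ) = 1

theorem Convex.smul_add_smul_mem_of_zero_mem {E : Type*} [AddCommGroup E] [Module ℝ E]
    {K : Set E} (hK : Convex ℝ K) (h0 : (0 : E) ∈ K) {x y : E} (hx : x ∈ K) (hy : y ∈ K)
    {a b : ℝ} (ha : 0 ≤ a) (hb : 0 ≤ b) (hab : a + b ≤ 1) : a • x + b • y ∈ K := by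
  rcases (add_nonneg ha hb).eq_or_lt with h | h
  · obtain rfl : a = 0 := by linarith
    obtain rfl : b = 0 := by linarith
    simpa using h0
  · have h1 : (a / (a + b)) • x + (b / (a + b)) • y ∈ K :=
      hK hx hy (by positivity) (by positivity) (by field_simp)
    have h2 := hK.smul_mem_of_zero_mem h0 h1 ⟨h.le, hab⟩
    rwa [smul_add, smul_smul, smul_smul, mul_div_cancel₀ _ h.ne', mul_div_cancel₀ _ h.ne'] at h2

theorem exists_pos_add_smul_mem_of_mem_interior {E : Type*} [AddCommGroup E] [Module ℝ E]
    [TopologicalSpace E] [ContinuousAdd E] [ContinuousSMul ℝ E] {K : Set E} {m : E}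
    (hm : m ∈ interior K) (w : E) : ∃ ε : ℝ, 0 < ε ∧ m + ε • w ∈ K := by
  have hc : Continuous fun ε : ℝ => m + ε • w := by fun_prop
  have h1 : ∀ᶠ ε : ℝ in nhds 0, m + ε • w ∈ K :=
    hc.continuousAt.eventually (by simpa using mem_interior_iff_mem_nhds.1 hm)
  obtain ⟨ε, h, hε⟩ := ((h1.filter_mono nhdsWithin_le_nhds).and
    (self_mem_nhdsWithin : Ioi (0 : ℝ) ∈ nhdsWithin 0 (Ioi 0))).exists
  exact ⟨ε, hε, h⟩

theorem lat_add {n : ℕ} {x y : Fin n → ℝ} (hx : x ∈ lat n) (hy : y ∈ lat n) : x + y ∈ lat n := by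
  intro i
  obtain ⟨a, ha⟩ := hx i
  obtain ⟨b, hb⟩ := hy i
  exact ⟨a + b, by simp [ha, hb]⟩

theorem lat_zsmul {n : ℕ} (k : ℤ) {x : Fin n → ℝ} (hx : x ∈ lat n) : (k : ℝ) • x ∈ lat n := by
  intro i
  obtain ⟨a, ha⟩ := hx i
  exact ⟨k * a, by simp [ha]⟩

theorem lat_neg {n : ℕ} {x : Fin n → ℝ} (hx : x ∈ lat n) : -x ∈ lat n := by
  simpa using lat_zsmul (-1) hx

/-- Let `K` be a lattice polygon with vertex `0` and single interior lattice point `m`, and let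
`u, m` be a lattice basis with dual basis `X, Y`. Then on the side of `u` the cone of `K` at `0` is
bounded by a ray through a point `u + k • m` of `K`. -/
theorem exists_lattice_edge {K T : Set (Fin 2 → ℝ)} (hKT : K = convexHull ℝ T) (hT : T ⊆ lat 2)
    (hcomp : IsCompact K) (h0 : 0 ∈ extremePoints ℝ K) {u m : Fin 2 → ℝ} (hu : u ∈ lat 2)
    (hint : interior K ∩ lat 2 = {m}) (X Y : (Fin 2 → ℝ) →ₗ[ℝ] ℝ)
    (hX : ∀ z ∈ lat 2, ∃ a : ℤ, X z = a) (hY : ∀ z ∈ lat 2, ∃ a : ℤ, Y z = a)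
    (hXY : ∀ z, z = X z • u + Y z • m) (hXu : X u = 1) (hXm : X m = 0) (hYu : Y u = 0)
    (hYm : Y m = 1) :
    ∃ k : ℤ, u + (k : ℝ) • m ∈ K ∧ ∀ z ∈ K, k * X z ≤ Y z := by
  have hK : Convex ℝ K := hKT ▸ convex_convexHull ℝ T
  have hTK : T ⊆ K := hKT ▸ subset_convexHull ℝ T
  have h0K : 0 ∈ K := h0.1
  have hm : m ∈ interior K ∩ lat 2 := hint ▸ rfl
  have hmK : m ∈ K := interior_subset hm.1
  obtain ⟨q, hqT, hq⟩ : ∃ q ∈ T, 0 < X q := by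
    by_contra! h
    have hsub : K ⊆ {z | X z ≤ 0} :=
      hKT ▸ convexHull_min h (convex_halfSpace_le X.isLinear 0)
    obtain ⟨ε, hε, hmem⟩ := exists_pos_add_smul_mem_of_mem_interior hm.1 u
    have := hsub hmem
    simp [hXm, hXu] at this
    linarith
  have hne : ∃ k : ℤ, u + (k : ℝ) • m ∈ K := by
    obtain ⟨a, ha⟩ := hX q (hT hqT)
    obtain ⟨b, hb⟩ := hY q (hT hqT)
    have ha0 : 0 < a := by rw [ha] at hq; exact_mod_cast hq
    have har : (0 : ℝ) < a := by exact_mod_cast ha0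
    have h1 := Int.emod_nonneg (-b) ha0.ne'
    have h2 := Int.emod_lt_of_pos (-b) ha0
    have h3 := Int.emod_add_mul_ediv (-b) a
    set r := (-b) % a
    set e := (-b) / a
    have h3' : (r : ℝ) + a * e = -b := by exact_mod_cast h3
    refine ⟨-e, ?_⟩
    have hr : (0 : ℝ) ≤ r := by exact_mod_cast h1
    have hra : (1 : ℝ) + r ≤ a := by
      have : 1 + r ≤ a := by omega
      exact_mod_cast this
    have h4 := hK.smul_add_smul_mem_of_zero_mem h0K (hTK hqT) hmK (a := 1 / a) (b := r / a)
      (by positivity) (by positivity) (by rw [← add_div, div_le_one har]; exact hra)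
    convert h4 using 1
    conv_rhs => rw [hXY q, ha, hb]
    match_scalars
    · field_simp
    · field_simp
      linarith
  have hbdd : ∃ B : ℤ, ∀ k : ℤ, u + (k : ℝ) • m ∈ K → B ≤ k := by
    obtain ⟨B, hB⟩ := hcomp.bddBelow_image
      (LinearMap.continuous_of_finiteDimensional Y).continuousOn
    refine ⟨⌊B⌋, fun k hk => ?_⟩
    have h1 := hB ⟨_, hk, rfl⟩
    simp [hYu, hYm] at h1
    exact_mod_cast (Int.floor_le B).trans h1
  obtain ⟨k, hpK, hmin⟩ := Int.exists_least_of_bdd hbdd hne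
  refine ⟨k, hpK, ?_⟩
  suffices hTs : T ⊆ {z | 0 ≤ (Y - (k : ℝ) • X) z} by
    have hsub : K ⊆ {z | 0 ≤ (Y - (k : ℝ) • X) z} :=
      hKT ▸ convexHull_min hTs (convex_halfSpace_ge (Y - (k : ℝ) • X).isLinear 0)
    intro z hz
    have := hsub hz
    simp at this
    linarith
  intro q hqT
  obtain ⟨a, ha⟩ := hX q (hT hqT)
  obtain ⟨b, hb⟩ := hY q (hT hqT)
  have hqK := hTK hqT
  suffices 0 ≤ b - k * a by
    simp only [mem_ofPred_eq, LinearMap.sub_apply, LinearMap.smul_apply, smul_eq_mul, ha, hb]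
    exact_mod_cast this
  by_contra! hneg
  obtain ⟨j, hj⟩ : ∃ j, j = k * a - b := ⟨_, rfl⟩
  have hj0 : 0 < j := by omega
  have hjr : (0 : ℝ) < j := by exact_mod_cast hj0
  have hjr' : (j : ℝ) = k * a - b := by exact_mod_cast hj
  set p := u + (k : ℝ) • m with hp
  have hq : q = (a : ℝ) • p - (j : ℝ) • m := by
    conv_lhs => rw [hXY q, ha, hb]
    rw [hp, hjr']
    module
  rcases le_or_gt a 0 with ha0 | ha0
  · have har : (a : ℝ) ≤ 0 := by exact_mod_cast ha0
    have hpos : (0 : ℝ) < 1 - a := by linarith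
    have hz : (1 / (1 - a : ℝ)) • q + (-a / (1 - a : ℝ)) • p ∈ K :=
      hK hqK hpK (by positivity) (div_nonneg (by linarith) hpos.le)
        (by field_simp; ring)
    have hm0 : m = 0 := by
      refine (mem_extremePoints_iff_left.1 h0).2 m hmK _ hz ?_
      have hpos' : (0 : ℝ) < 1 - a + j := by linarith
      refine ⟨j / (1 - a + j), (1 - a) / (1 - a + j), by positivity, by positivity,
        by field_simp; ring, ?_⟩
      rw [hq]
      match_scalars <;> field_simp <;> ring
    simp [hm0] at hYm
  have har : (0 : ℝ) < a := by exact_mod_cast ha0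
  rcases le_or_gt a j with haj | haj
  · have hajr : (a : ℝ) ≤ j := by exact_mod_cast haj
    have ha1 : (1 : ℝ) ≤ a := by exact_mod_cast ha0
    have hmem := hK.smul_add_smul_mem_of_zero_mem h0K hqK hpK (a := 1 / j) (b := 1 - a / j)
      (by positivity) (by rw [sub_nonneg, div_le_one hjr]; exact hajr)
      (by field_simp; linarith)
    have : k ≤ k - 1 := by
      refine hmin (k - 1) ?_
      convert hmem using 1
      rw [hq, hp]
      match_scalars <;> field_simp <;> ring
    omega
  · have hajr : (j : ℝ) + 1 ≤ a := by exact_mod_cast haj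
    have hz : (1 / (a - j : ℝ)) • q ∈ K :=
      hK.smul_mem_of_zero_mem h0K hqK
        ⟨div_nonneg one_pos.le (by linarith), by rw [div_le_one (by linarith)]; linarith⟩
    have hpint : (j / a : ℝ) • m + (1 - j / a : ℝ) • (1 / (a - j : ℝ)) • q ∈ interior K :=
      hK.combo_interior_self_mem_interior hm.1 hz (by positivity)
        (by rw [sub_nonneg, div_le_one har]; linarith) (by ring)
    have haj' : (a - j : ℝ) ≠ 0 := by linarith
    have hpeq : (j / a : ℝ) • m + (1 - j / a : ℝ) • (1 / (a - j : ℝ)) • q = p := by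
      rw [hq]
      match_scalars <;> field_simp
      ring
    rw [hpeq] at hpint
    have hpm : p ∈ ({m} : Set _) := hint ▸ ⟨hpint, lat_add hu (lat_zsmul k hm.2)⟩
    have := congrArg X (mem_singleton_iff.1 hpm)
    simp [hp, hXu, hXm] at this

/-- The single interior lattice point of a lattice polygon with vertex `0` is part of a lattice
basis. -/
theorem exists_det_eq_one {K : Set (Fin 2 → ℝ)} (hK : Convex ℝ K) (h0 : 0 ∈ extremePoints ℝ K)
    {m : Fin 2 → ℝ} (hint : interior K ∩ lat 2 = {m}) :
    ∃ u ∈ lat 2, u 0 * m 1 - u 1 * m 0 = 1 := by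
  have hm : m ∈ interior K ∩ lat 2 := hint ▸ rfl
  have hm0 : m ≠ 0 := by
    intro hm0
    have h0i : (0 : Fin 2 → ℝ) ∈ interior K := hm0 ▸ hm.1
    obtain ⟨ε, hε, hx⟩ := exists_pos_add_smul_mem_of_mem_interior h0i 1
    obtain ⟨δ, hδ, hy⟩ := exists_pos_add_smul_mem_of_mem_interior h0i (-1)
    have h := (mem_extremePoints_iff_left.1 h0).2 _ hx _ hy
      ⟨δ / (δ + ε), ε / (δ + ε), by positivity, by positivity, by field_simp,
        by match_scalars; field_simp; ring⟩
    have := congrFun h 0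
    simp at this
    exact hε.ne' this
  obtain ⟨c, hc⟩ := hm.2 0
  obtain ⟨d, hd⟩ := hm.2 1
  have hcd : c ≠ 0 ∨ d ≠ 0 := by
    by_contra! h
    refine hm0 (funext fun i => ?_)
    fin_cases i <;> simp [hc, hd, h.1, h.2]
  have hg : 0 < Int.gcd c d := Int.gcd_pos_iff.2 hcd
  have hgr : (0 : ℝ) < Int.gcd c d := by exact_mod_cast hg
  have hg1r : (1 : ℝ) ≤ Int.gcd c d := by exact_mod_cast hg
  obtain ⟨c', hc'⟩ := Int.gcd_dvd_left c d
  obtain ⟨d', hd'⟩ := Int.gcd_dvd_right c d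
  have hcr : (c : ℝ) = Int.gcd c d * c' := by exact_mod_cast hc'
  have hdr : (d : ℝ) = Int.gcd c d * d' := by exact_mod_cast hd'
  have hmem : (1 / (Int.gcd c d : ℝ)) • m ∈ interior K := by
    have := hK.combo_interior_self_mem_interior hm.1 h0.1
      (a := 1 / (Int.gcd c d : ℝ)) (b := 1 - 1 / (Int.gcd c d : ℝ)) (by positivity)
      (by rw [sub_nonneg, div_le_one hgr]; exact hg1r) (by ring)
    simpa using this
  have hlat : (1 / (Int.gcd c d : ℝ)) • m ∈ lat 2 := by
    intro i
    fin_cases i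
    · exact ⟨c', by simp only [Pi.smul_apply, smul_eq_mul, Fin.zero_eta, hc]; rw [hcr]; field_simp⟩
    · exact ⟨d', by simp only [Pi.smul_apply, smul_eq_mul, Fin.mk_one, hd]; rw [hdr]; field_simp⟩
  have heq : (1 / (Int.gcd c d : ℝ)) • m = m := by
    have : (1 / (Int.gcd c d : ℝ)) • m ∈ ({m} : Set _) := hint ▸ ⟨hmem, hlat⟩
    exact this
  have hg1 : (Int.gcd c d : ℝ) = 1 := by
    have h2 : (1 / (Int.gcd c d : ℝ) - 1) • m = 0 := by rw [sub_smul, heq, one_smul, sub_self]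
    have h3 := (smul_eq_zero.1 h2).resolve_right hm0
    field_simp at h3
    linarith
  have hbez := Int.gcd_eq_gcd_ab c d
  have hbezr : (Int.gcd c d : ℝ) = c * Int.gcdA c d + d * Int.gcdB c d := by exact_mod_cast hbez
  refine ⟨![(Int.gcdB c d : ℝ), -(Int.gcdA c d : ℝ)], ?_, ?_⟩
  · intro i
    fin_cases i
    · exact ⟨Int.gcdB c d, by simp⟩
    · exact ⟨-Int.gcdA c d, by simp⟩
  · simp [hc, hd]
    linarith

/-- A lattice polygon with a single interior lattice point is Gorenstein at a vertex placed at the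
origin. -/
theorem gorensteinAt_zero {K T : Set (Fin 2 → ℝ)} (hKT : K = convexHull ℝ T) (hT : T ⊆ lat 2)
    (hcomp : IsCompact K) (h0 : 0 ∈ extremePoints ℝ K) {m : Fin 2 → ℝ}
    (hint : interior K ∩ lat 2 = {m}) : GorensteinAt 2 K 0 := by
  have hK : Convex ℝ K := hKT ▸ convex_convexHull ℝ T
  have hm : m ∈ interior K ∩ lat 2 := hint ▸ rfl
  have hmK : m ∈ K := interior_subset hm.1
  obtain ⟨u, hu, hdet⟩ := exists_det_eq_one hK h0 hint
  let π : Fin 2 → (Fin 2 → ℝ) →ₗ[ℝ] ℝ := LinearMap.proj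
  obtain ⟨X, hXdef⟩ : ∃ X, X = m 1 • π 0 - m 0 • π 1 := ⟨_, rfl⟩
  obtain ⟨Y, hYdef⟩ : ∃ Y, Y = u 0 • π 1 - u 1 • π 0 := ⟨_, rfl⟩
  have hXz : ∀ z, X z = m 1 * z 0 - m 0 * z 1 := fun z => by simp [hXdef, π]
  have hYz : ∀ z, Y z = u 0 * z 1 - u 1 * z 0 := fun z => by simp [hYdef, π]
  have hX : ∀ z ∈ lat 2, ∃ a : ℤ, X z = a := by
    intro z hz
    obtain ⟨a, ha⟩ := hz 0
    obtain ⟨b, hb⟩ := hz 1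
    obtain ⟨c, hc⟩ := hm.2 0
    obtain ⟨d, hd⟩ := hm.2 1
    exact ⟨d * a - c * b, by rw [hXz, ha, hb, hc, hd]; push_cast; ring⟩
  have hY : ∀ z ∈ lat 2, ∃ a : ℤ, Y z = a := by
    intro z hz
    obtain ⟨a, ha⟩ := hz 0
    obtain ⟨b, hb⟩ := hz 1
    obtain ⟨c, hc⟩ := hu 0
    obtain ⟨d, hd⟩ := hu 1
    exact ⟨c * b - d * a, by rw [hYz, ha, hb, hc, hd]; push_cast; ring⟩
  have hXY : ∀ z, z = X z • u + Y z • m := by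
    intro z
    ext i
    fin_cases i
    · simp [hXz, hYz]; linear_combination -z 0 * hdet
    · simp [hXz, hYz]; linear_combination -z 1 * hdet
  have hXu : X u = 1 := by rw [hXz]; linarith
  have hXm : X m = 0 := by rw [hXz]; ring
  have hYu : Y u = 0 := by rw [hYz]; ring
  have hYm : Y m = 1 := by rw [hYz]; linarith
  obtain ⟨k, hpK, hk⟩ := exists_lattice_edge hKT hT hcomp h0 hu hint X Y hX hY hXY hXu hXm hYu hYm
  obtain ⟨l, hlK, hl⟩ := exists_lattice_edge hKT hT hcomp h0 (lat_neg hu) hint (-X) Y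
    (fun z hz => by
      obtain ⟨a, ha⟩ := hX z hz
      exact ⟨-a, by simp [ha]⟩)
    hY (fun z => by simpa using hXY z) (by simp [hXu]) (by simp [hXm]) (by simp [hYu]) hYm
  have hcone : ∀ z, z ∈ coneAt 2 K 0 ↔ k * X z ≤ Y z ∧ l * -X z ≤ Y z := by
    have hcomb : ∀ p ∈ K, ∀ z, ∀ a b : ℝ, 0 ≤ a → 0 ≤ b → z = a • p + b • m →
        z ∈ coneAt 2 K 0 := by
      intro p hp z a b ha hb hz
      have hpos : 0 < 1 + a + b := by positivity
      refine ⟨1 + a + b, hpos.le, (a / (1 + a + b)) • p + (b / (1 + a + b)) • m,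
        hK.smul_add_smul_mem_of_zero_mem h0.1 hp hmK (by positivity) (by positivity)
          (by rw [← add_div, div_le_one hpos]; linarith), ?_⟩
      rw [hz, sub_zero]
      match_scalars <;> field_simp
    intro z
    constructor
    · rintro ⟨r, hr, x, hx, rfl⟩
      have h1 := mul_le_mul_of_nonneg_left (hk x hx) hr
      have h2 := mul_le_mul_of_nonneg_left (hl x hx) hr
      simp at h1 h2 ⊢
      constructor <;> linarith
    · rintro ⟨h1, h2⟩
      rcases le_total 0 (X z) with h | h
      · refine hcomb _ hpK z (X z) (Y z - k * X z) h (by linarith) ?_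
        conv_lhs => rw [hXY z]
        module
      · refine hcomb _ hlK z (-X z) (Y z - l * -X z) (by linarith) (by linarith) ?_
        conv_lhs => rw [hXY z]
        module
  have hXc : Continuous X := LinearMap.continuous_of_finiteDimensional X
  have hYc : Continuous Y := LinearMap.continuous_of_finiteDimensional Y
  have hicone : ∀ z, z ∈ interior (coneAt 2 K 0) ↔ k * X z < Y z ∧ l * -X z < Y z := by
    intro z
    constructor
    · intro hz
      obtain ⟨ε, hε, hmem⟩ := exists_pos_add_smul_mem_of_mem_interior hz (-m)
      have := (hcone _).1 hmem
      simp [hXm, hYm] at this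
      constructor <;> linarith
    · intro hz
      have hopen : IsOpen ({z | k * X z < Y z} ∩ {z | l * -X z < Y z}) :=
        (isOpen_lt (by fun_prop) (by fun_prop)).inter (isOpen_lt (by fun_prop) (by fun_prop))
      exact interior_maximal (fun w hw => (hcone w).2 ⟨hw.1.le, hw.2.le⟩) hopen hz
  refine ⟨m, ⟨(hcone m).2 (by simp [hXm, hYm]), hm.2⟩, ?_⟩
  ext z
  constructor
  · rintro ⟨hz, hzl⟩
    refine ⟨z - m, ⟨(hcone _).2 ?_, by
      rw [sub_eq_add_neg]; exact lat_add hzl (lat_neg hm.2)⟩, by simp⟩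
    rw [hicone] at hz
    obtain ⟨a, ha⟩ := hX z hzl
    obtain ⟨b, hb⟩ := hY z hzl
    simp only [map_sub, hXm, hYm, sub_zero]
    rw [ha, hb] at hz ⊢
    obtain ⟨h1, h2⟩ := hz
    have h1' : k * a < b := by exact_mod_cast h1
    have h2' : l * -a < b := by exact_mod_cast h2
    constructor
    · have : k * a ≤ b - 1 := by omega
      exact_mod_cast this
    · have : l * -a ≤ b - 1 := by omega
      exact_mod_cast this
  · rintro ⟨y, ⟨hy, hyl⟩, rfl⟩
    refine ⟨(hicone _).2 ?_, lat_add hm.2 hyl⟩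
    have := (hcone _).1 hy
    simp only [map_add, hXm, hYm, zero_add]
    constructor <;> linarith

/-- A lattice polygon with exactly one interior lattice point is Gorenstein. -/
theorem polygon_one_interior_point_gorenstein (P : Set (Fin 2 → ℝ))
    (hP : IsLatticePolytope 2 P)
    (hint : ∃ m₀, interior P ∩ lat 2 = {m₀}) :
    Gorenstein 2 P := by
  intro v hv
  obtain ⟨⟨S, -, hPS⟩, -⟩ := hP
  obtain ⟨m₀, hm₀⟩ := hint
  set T := (fun m : Fin 2 → ℤ => fun i => (m i : ℝ)) '' (S : Set (Fin 2 → ℤ))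
  have hTlat : T ⊆ lat 2 := by
    rintro _ ⟨s, -, rfl⟩ i
    exact ⟨s i, rfl⟩
  have hvlat : v ∈ lat 2 := hTlat (extremePoints_convexHull_subset (𝕜 := ℝ) (hPS ▸ hv))
  have hTfin : T.Finite := S.finite_toSet.image _
  have hPcomp : IsCompact P := hPS ▸ hTfin.isCompact_convexHull ℝ
  have hmem : ∀ x, x ∈ -v +ᵥ P ↔ v + x ∈ P := by
    intro x
    rw [mem_vadd_set_iff_neg_vadd_mem, neg_neg, vadd_eq_add]
  have hcone : coneAt 2 P v = coneAt 2 (-v +ᵥ P) 0 := by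
    ext y
    constructor
    · rintro ⟨r, hr, x, hx, rfl⟩
      exact ⟨r, hr, x - v, (hmem _).2 (by simpa using hx), by simp⟩
    · rintro ⟨r, hr, x, hx, rfl⟩
      exact ⟨r, hr, v + x, (hmem _).1 hx, by simp⟩
  have key : GorensteinAt 2 (-v +ᵥ P) 0 := by
    refine gorensteinAt_zero (T := -v +ᵥ T) (m := m₀ - v) ?_ ?_ (hPcomp.vadd _) ?_ ?_
    · rw [convexHull_vadd, ← hPS]
    · rintro _ ⟨t, ht, rfl⟩
      exact lat_add (lat_neg hvlat) (hTlat ht)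
    · rw [mem_extremePoints_iff_left]
      refine ⟨(hmem 0).2 (by simpa using hv.1), fun x hx y hy hxy => ?_⟩
      have h := (mem_extremePoints_iff_left.1 hv).2 _ ((hmem x).1 hx) _ ((hmem y).1 hy) ?_
      · simpa using h
      · obtain ⟨a, b, ha, hb, hab, h⟩ := hxy
        refine ⟨a, b, ha, hb, hab, ?_⟩
        rw [smul_add, smul_add, add_add_add_comm, h, ← add_smul, hab, one_smul, add_zero]
    · ext z
      have h1 : z ∈ interior (-v +ᵥ P) ↔ v + z ∈ interior P := by
        rw [interior_vadd, mem_vadd_set_iff_neg_vadd_mem, neg_neg, vadd_eq_add]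
      have h2 : z ∈ lat 2 ↔ v + z ∈ lat 2 :=
        ⟨lat_add hvlat, fun h => by simpa using lat_add (lat_neg hvlat) h⟩
      rw [mem_inter_iff, h1, h2, ← mem_inter_iff, hm₀, mem_singleton_iff, mem_singleton_iff,
        eq_sub_iff_add_eq, add_comm]
  unfold GorensteinAt at key ⊢
  rwa [hcone]
end
end

section
/- Let P ⊆ ℝ³ be a lattice 3-polytope such that the topological interior of the dilate 2P contains exactly one point of ℤ³. Then P is Gorenstein, i.e. it is Gorenstein at every vertex. -/
open Set Pointwise

noncomputable section

open Finset in
/-- Conic Carathéodory with a distinguished vector `m`: a nonnegative combination of `m` and the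
`g i` with positive coefficient at `m` can be rewritten so that either the coefficient of `m` is at
least `1`, or the vectors involved are linearly independent. -/
lemma exists_conic_combination_large_or_independent {ι E : Type*} [AddCommGroup E] [Module ℝ E]
    (m y : E) (g : ι → E) (T : Finset ι) (t : ℝ) (ht : 0 < t) (l : ι → ℝ) (hl : ∀ i, 0 ≤ l i)
    (hy : y = t • m + ∑ i ∈ T, l i • g i) :
    ∃ T' ⊆ T, ∃ t' : ℝ, 0 < t' ∧ ∃ l' : ι → ℝ, (∀ i, 0 ≤ l' i) ∧
      y = t' • m + ∑ i ∈ T', l' i • g i ∧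
      (1 ≤ t' ∨ ∀ (a : ℝ) (c : ι → ℝ), a • m + ∑ i ∈ T', c i • g i = 0 →
        a = 0 ∧ ∀ i ∈ T', c i = 0) := by
  classical
  induction T using Finset.strongInduction generalizing t l with
  | H T ih =>
  by_cases hind : ∀ (a : ℝ) (c : ι → ℝ), a • m + ∑ i ∈ T, c i • g i = 0 →
      a = 0 ∧ ∀ i ∈ T, c i = 0
  · exact ⟨T, subset_rfl, t, ht, l, hl, hy, Or.inr hind⟩
  have hrel : ∃ (a : ℝ) (c : ι → ℝ), a • m + ∑ i ∈ T, c i • g i = 0 ∧ 0 ≤ a ∧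
      (0 < a ∨ ∃ i ∈ T, c i < 0) := by
    push Not at hind
    obtain ⟨a, c, h0, hne⟩ := hind
    have hneg : (-a) • m + ∑ i ∈ T, (-c i) • g i = 0 := by
      simp only [neg_smul, sum_neg_distrib]
      rw [← neg_add, h0, neg_zero]
    rcases lt_trichotomy a 0 with ha | ha | ha
    · exact ⟨-a, fun i => -c i, hneg, by linarith, Or.inl (by linarith)⟩
    · obtain ⟨i, hi, hci⟩ := hne ha
      rcases lt_or_gt_of_ne hci with h | h
      · exact ⟨a, c, h0, ha.ge, Or.inr ⟨i, hi, h⟩⟩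
      · exact ⟨-a, fun i => -c i, hneg, by linarith, Or.inr ⟨i, hi, by simpa using h⟩⟩
    · exact ⟨a, c, h0, ha.le, Or.inl ha⟩
  obtain ⟨a, c, h0, ha, hac⟩ := hrel
  have hmove : ∀ τ : ℝ, y = (t + τ * a) • m + ∑ i ∈ T, (l i + τ * c i) • g i := by
    intro τ
    have : y = (t • m + ∑ i ∈ T, l i • g i) + τ • (a • m + ∑ i ∈ T, c i • g i) := by
      rw [h0, smul_zero, add_zero, hy]
    rw [this]
    simp only [add_smul, smul_add, smul_sum, sum_add_distrib, mul_smul]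
    abel
  by_cases hneg : ∃ i ∈ T, c i < 0
  · have hne : (T.filter fun i => c i < 0).Nonempty := by
      obtain ⟨i, hi, hci⟩ := hneg
      exact ⟨i, mem_filter.2 ⟨hi, hci⟩⟩
    obtain ⟨j, hj, hmin⟩ := exists_min_image _ (fun i => l i / (-c i)) hne
    obtain ⟨hjT, hcj⟩ := mem_filter.1 hj
    set τ := l j / (-c j) with hτ
    have hτ0 : 0 ≤ τ := div_nonneg (hl j) (by linarith)
    have hzero : l j + τ * c j = 0 := by
      rw [hτ, div_neg, neg_mul, div_mul_cancel₀ _ hcj.ne, add_neg_cancel]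
    have hnn : ∀ i ∈ T, 0 ≤ l i + τ * c i := by
      intro i hi
      rcases lt_or_ge (c i) 0 with h | h
      · have := hmin i (mem_filter.2 ⟨hi, h⟩)
        rw [le_div_iff₀ (by linarith)] at this
        linarith
      · have := mul_nonneg hτ0 h
        linarith [hl i]
    obtain ⟨T', hT', h⟩ := ih (T.erase j) (erase_ssubset hjT) (t + τ * a)
      (by have := mul_nonneg hτ0 ha; linarith)
      (fun i => max (l i + τ * c i) 0) (fun i => le_max_right _ _) (by
        rw [hmove τ, ← add_sum_erase T _ hjT, hzero, zero_smul, zero_add]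
        congr 1
        refine sum_congr rfl fun i hi => ?_
        rw [max_eq_left (hnn i (mem_of_mem_erase hi))])
    exact ⟨T', hT'.trans (erase_subset _ _), h⟩
  · have hapos : 0 < a := hac.resolve_right hneg
    push Not at hneg
    refine ⟨T, subset_rfl, t + a⁻¹ * a, ?_, fun i => max (l i + a⁻¹ * c i) 0,
      fun i => le_max_right _ _, ?_, Or.inl ?_⟩
    · positivity
    · rw [hmove a⁻¹]
      congr 1
      refine sum_congr rfl fun i hi => ?_
      have := mul_nonneg (inv_nonneg.2 ha) (hneg i hi)
      dsimp only
      rw [max_eq_left (add_nonneg (hl i) this)]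
    · rw [inv_mul_cancel₀ hapos.ne']
      linarith

lemma mem_coneAt_convexHull_iff {n : ℕ} (S : Finset (Fin n → ℝ)) {v : Fin n → ℝ}
    (hv : v ∈ convexHull ℝ (S : Set (Fin n → ℝ))) (y : Fin n → ℝ) :
    y ∈ coneAt n (convexHull ℝ (S : Set (Fin n → ℝ))) v ↔
      ∃ l : (Fin n → ℝ) → ℝ, (∀ s, 0 ≤ l s) ∧ y = ∑ s ∈ S, l s • (s - v) := by
  classical
  constructor
  · rintro ⟨r, hr, x, hx, rfl⟩
    obtain ⟨w, hw0, hw1, rfl⟩ := Finset.mem_convexHull'.1 hx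
    refine ⟨fun s => r * max (w s) 0, fun s => mul_nonneg hr (le_max_right _ _), ?_⟩
    have hv' : v = ∑ s ∈ S, w s • v := by rw [← Finset.sum_smul, hw1, one_smul]
    conv_lhs => rw [hv']
    rw [← Finset.sum_sub_distrib, Finset.smul_sum]
    refine Finset.sum_congr rfl fun s hs => ?_
    dsimp only
    rw [max_eq_left (hw0 s hs), mul_smul, smul_sub (w s)]
  · rintro ⟨l, hl, rfl⟩
    rcases (Finset.sum_nonneg fun s (_ : s ∈ S) => hl s).eq_or_lt' with h0 | hpos
    · refine ⟨0, le_rfl, v, hv, ?_⟩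
      rw [zero_smul]
      refine Finset.sum_eq_zero fun s hs => ?_
      rw [(Finset.sum_eq_zero_iff_of_nonneg fun s _ => hl s).1 h0 s hs, zero_smul]
    · refine ⟨_, hpos.le, S.centerMass l id, Finset.centerMass_mem_convexHull S
        (fun s _ => hl s) hpos (fun s hs => hs), ?_⟩
      rw [Finset.centerMass, smul_sub, smul_inv_smul₀ hpos.ne', Finset.sum_smul,
        ← Finset.sum_sub_distrib]
      simp [smul_sub]

lemma coneAt_add_mem {n : ℕ} (S : Finset (Fin n → ℝ)) {v : Fin n → ℝ}
    (hv : v ∈ convexHull ℝ (S : Set (Fin n → ℝ))) {x y : Fin n → ℝ}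
    (hx : x ∈ coneAt n (convexHull ℝ (S : Set (Fin n → ℝ))) v)
    (hy : y ∈ coneAt n (convexHull ℝ (S : Set (Fin n → ℝ))) v) :
    x + y ∈ coneAt n (convexHull ℝ (S : Set (Fin n → ℝ))) v := by
  rw [mem_coneAt_convexHull_iff S hv] at *
  obtain ⟨l, hl, rfl⟩ := hx
  obtain ⟨l', hl', rfl⟩ := hy
  exact ⟨fun s => l s + l' s, fun s => add_nonneg (hl s) (hl' s), by
    simp [add_smul, Finset.sum_add_distrib]⟩

lemma coneAt_smul_mem {n : ℕ} {P : Set (Fin n → ℝ)} {v x : Fin n → ℝ} {r : ℝ} (hr : 0 ≤ r)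
    (hx : x ∈ coneAt n P v) : r • x ∈ coneAt n P v := by
  obtain ⟨a, ha, p, hp, rfl⟩ := hx
  exact ⟨r * a, mul_nonneg hr ha, p, hp, (mul_smul _ _ _).symm⟩

/-- The lattice `ℤⁿ` as an additive subgroup of `ℝⁿ`. -/
def latSubgroup (n : ℕ) : AddSubgroup (Fin n → ℝ) where
  carrier := lat n
  zero_mem' := fun _ => ⟨0, by simp⟩
  add_mem' := by
    intro x y hx hy i
    obtain ⟨a, ha⟩ := hx i
    obtain ⟨b, hb⟩ := hy i
    exact ⟨a + b, by simp [ha, hb]⟩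
  neg_mem' := by
    intro x hx i
    obtain ⟨a, ha⟩ := hx i
    exact ⟨-a, by simp [ha]⟩

lemma mem_latSubgroup {n : ℕ} {x : Fin n → ℝ} : x ∈ latSubgroup n ↔ x ∈ lat n := Iff.rfl

/-- A combination of an interior point `m` of `kP` and points of the polytope, of total degree at
most `k` with respect to the vertex `v`, lies in the interior of `kP` after translation. -/
lemma combination_mem_interior_dilate {n k : ℕ} {P : Set (Fin n → ℝ)} (hP : Convex ℝ P)
    {v m : Fin n → ℝ} (hv : v ∈ P) (hm : m ∈ interior (dilate n k P))
    (T : Finset (Fin n → ℝ)) (hT : ∀ s ∈ T, s ∈ P) {t : ℝ} (ht0 : 0 < t) (ht1 : t < 1)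
    (u : (Fin n → ℝ) → ℝ) (hu : ∀ s, 0 ≤ u s) (hk : 0 < k)
    (hdeg : k * t + ∑ s ∈ T, u s ≤ k) :
    t • (m - (k : ℝ) • v) + ∑ s ∈ T, u s • (s - v) + (k : ℝ) • v ∈ interior (dilate n k P) := by
  have hkR : (0 : ℝ) < k := Nat.cast_pos.2 hk
  have hconv : Convex ℝ (dilate n k P) := hP.smul (k : ℝ)
  set d : ℝ := k * (1 - t) with hd
  have hdpos : 0 < d := mul_pos hkR (by linarith)
  have hq : d⁻¹ • (∑ s ∈ T, u s • s + (d - ∑ s ∈ T, u s) • v) ∈ P := by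
    have hmem : v + ∑ s ∈ T, (d⁻¹ * u s) • (s - v) ∈ P := by
      rcases (Finset.sum_nonneg fun s (_ : s ∈ T) => hu s).eq_or_lt' with h0 | hpos
      · rw [Finset.sum_eq_zero fun s hs => ?_, add_zero]
        · exact hv
        · rw [(Finset.sum_eq_zero_iff_of_nonneg fun s _ => hu s).1 h0 s hs, mul_zero, zero_smul]
      · have hc : T.centerMass u id ∈ P := hP.centerMass_mem (fun s _ => hu s) hpos hT
        have := hP.add_smul_sub_mem hv hc (t := d⁻¹ * ∑ s ∈ T, u s)
          ⟨by positivity, by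
            rw [inv_mul_le_iff₀ hdpos, mul_one, hd]
            linarith⟩
        convert this using 2
        rw [Finset.centerMass, mul_smul, smul_sub (∑ s ∈ T, u s), smul_inv_smul₀ hpos.ne',
          Finset.sum_smul, ← Finset.sum_sub_distrib, Finset.smul_sum]
        simp [smul_sub, mul_smul]
    convert hmem using 1
    simp only [smul_sub, mul_smul, Finset.sum_sub_distrib, smul_add, sub_smul,
      inv_smul_smul₀ hdpos.ne', Finset.smul_sum, Finset.sum_smul]
    abel
  have key := hconv.combo_interior_self_mem_interior hm (Set.mem_image_of_mem _ hq) ht0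
    (by linarith : 0 ≤ 1 - t) (by ring)
  convert key using 1
  have h1 : (1 - t) • (k : ℝ) • d⁻¹ • (∑ s ∈ T, u s • s + (d - ∑ s ∈ T, u s) • v) =
      ∑ s ∈ T, u s • s + (d - ∑ s ∈ T, u s) • v := by
    rw [smul_smul, mul_comm, ← hd, smul_inv_smul₀ hdpos.ne']
  rw [h1, hd]
  simp only [smul_sub, Finset.sum_sub_distrib, ← Finset.sum_smul]
  module

/-- If `n ≤ k + 1` and `kP` has a unique interior lattice point `m`, then `P` is Gorenstein at
each of its lattice points `v`, with generator `m - kv`. -/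
theorem gorensteinAt_of_unique_interior_point {n k : ℕ} (hk : 0 < k) (hnk : n ≤ k + 1)
    (S : Finset (Fin n → ℝ)) (hS : ∀ s ∈ S, s ∈ lat n) {m v : Fin n → ℝ}
    (hm : interior (dilate n k (convexHull ℝ (S : Set (Fin n → ℝ)))) ∩ lat n = {m})
    (hvP : v ∈ convexHull ℝ (S : Set (Fin n → ℝ))) (hv : v ∈ lat n) :
    GorensteinAt n (convexHull ℝ (S : Set (Fin n → ℝ))) v := by
  classical
  set P := convexHull ℝ (S : Set (Fin n → ℝ)) with hPdef
  have hconv : Convex ℝ P := convex_convexHull ℝ _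
  have hkR : (0 : ℝ) < k := Nat.cast_pos.2 hk
  obtain ⟨hmint, hmlat⟩ : m ∈ interior (dilate n k P) ∩ lat n := hm ▸ Set.mem_singleton m
  have hkv : (k : ℝ) • v ∈ lat n := by
    rw [← mem_latSubgroup, Nat.cast_smul_eq_nsmul]
    exact AddSubgroup.nsmul_mem _ hv k
  have hdilate : ∀ x ∈ dilate n k P, x - (k : ℝ) • v ∈ coneAt n P v := by
    rintro _ ⟨p, hp, rfl⟩
    exact ⟨k, hkR.le, p, hp, (smul_sub _ _ _).symm⟩
  have hm'cone := hdilate m (interior_subset hmint)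
  have hm'lat : m - (k : ℝ) • v ∈ lat n := (latSubgroup n).sub_mem hmlat hkv
  refine ⟨m - (k : ℝ) • v, ⟨hm'cone, hm'lat⟩, Set.Subset.antisymm ?_ ?_⟩
  · rintro y ⟨hyint, hylat⟩
    refine ⟨y - (m - (k : ℝ) • v), ⟨?_, (latSubgroup n).sub_mem hylat hm'lat⟩, by simp⟩
    obtain ⟨ε, hε, hyε⟩ : ∃ ε : ℝ, 0 < ε ∧ y - ε • (m - (k : ℝ) • v) ∈ coneAt n P v := by
      have hcont : Continuous fun ε : ℝ => y - ε • (m - (k : ℝ) • v) := by fun_prop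
      have hnhds : ∀ᶠ ε in nhds (0 : ℝ), y - ε • (m - (k : ℝ) • v) ∈ coneAt n P v :=
        hcont.continuousAt.eventually_mem (by simpa using mem_interior_iff_mem_nhds.1 hyint)
      obtain ⟨δ, hδ, hball⟩ := Metric.eventually_nhds_iff.1 hnhds
      exact ⟨δ / 2, by positivity, hball (by
        rw [Real.dist_eq, sub_zero, abs_of_pos (by positivity)]
        linarith)⟩
    obtain ⟨l₀, hl₀, hyl₀⟩ := (mem_coneAt_convexHull_iff S hvP _).1 hyε
    obtain ⟨T, hTS, t, ht0, l, hl, hyl, hor⟩ :=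
      exists_conic_combination_large_or_independent (m - (k : ℝ) • v) y (fun s => s - v) S ε hε l₀
        hl₀ (by rw [← hyl₀]; abel)
    have hTP : ∀ s ∈ T, s ∈ P := fun s hs => subset_convexHull ℝ _ (hTS hs)
    by_cases ht1 : 1 ≤ t
    · have hsum : ∑ s ∈ T, l s • (s - v) ∈ coneAt n P v := by
        refine Finset.sum_induction _ (· ∈ coneAt n P v) (fun _ _ => coneAt_add_mem S hvP)
          ⟨0, le_rfl, v, hvP, by simp⟩ fun s hs => ⟨l s, hl s, s, hTP s hs, rfl⟩
      have := coneAt_add_mem S hvP (coneAt_smul_mem (sub_nonneg.2 ht1) hm'cone) hsum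
      convert this using 1
      rw [hyl]
      module
    exfalso
    have hind := hor.resolve_left ht1
    push Not at ht1
    have hcard : T.card + 1 ≤ n := by
      let φ : (ℝ × (T → ℝ)) →ₗ[ℝ] (Fin n → ℝ) :=
        (LinearMap.toSpanSingleton ℝ _ (m - (k : ℝ) • v)).coprod
          (Fintype.linearCombination ℝ fun s : T => (s : Fin n → ℝ) - v)
      have hφ : Function.Injective φ := by
        rw [injective_iff_map_eq_zero]
        rintro ⟨a, c⟩ h
        obtain ⟨h1, h2⟩ := hind a (fun s => if hs : s ∈ T then c ⟨s, hs⟩ else 0) (by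
          rw [← h, ← Finset.sum_coe_sort T]
          simp [φ, Fintype.linearCombination_apply])
        ext s
        · exact h1
        · simpa using h2 s s.2
      have := LinearMap.finrank_le_finrank_of_injective hφ
      simp at this
      omega
    have hcontra : ∀ (τ : ℝ) (u : (Fin n → ℝ) → ℝ), 0 < τ → τ < 1 → (∀ s, 0 ≤ u s) →
        k * τ + ∑ s ∈ T, u s ≤ k →
        τ • (m - (k : ℝ) • v) + ∑ s ∈ T, u s • (s - v) ∈ lat n → False := by
      intro τ u hτ0 hτ1 hu hdeg hlat
      have hmem := combination_mem_interior_dilate hconv hvP hmint T hTP hτ0 hτ1 u hu hk hdeg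
      have heq : τ • (m - (k : ℝ) • v) + ∑ s ∈ T, u s • (s - v) + (k : ℝ) • v ∈ ({m} : Set _) :=
        hm ▸ ⟨hmem, (latSubgroup n).add_mem hlat hkv⟩
      rw [Set.mem_singleton_iff, ← eq_sub_iff_add_eq] at heq
      have := (hind (τ - 1) u (by
        rw [sub_smul, one_smul, sub_add_eq_add_sub, heq, sub_self])).1
      linarith
    have hgen : ∀ s ∈ T, s - v ∈ latSubgroup n := fun s hs =>
      (latSubgroup n).sub_mem (hS s (hTS hs)) hv
    have hfract : t • (m - (k : ℝ) • v) + ∑ s ∈ T, Int.fract (l s) • (s - v) ∈ latSubgroup n := by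
      have : t • (m - (k : ℝ) • v) + ∑ s ∈ T, Int.fract (l s) • (s - v) =
          y - ∑ s ∈ T, ⌊l s⌋ • (s - v) := by
        rw [hyl, add_sub_assoc, ← Finset.sum_sub_distrib]
        congr 1
        refine Finset.sum_congr rfl fun s _ => ?_
        rw [Int.fract, sub_smul, Int.cast_smul_eq_zsmul]
      rw [this]
      exact (latSubgroup n).sub_mem hylat
        ((latSubgroup n).sum_mem fun s hs => (latSubgroup n).zsmul_mem (hgen s hs) _)
    by_cases hdeg : k * t + ∑ s ∈ T, Int.fract (l s) ≤ k
    · exact hcontra t _ ht0 ht1 (fun s => Int.fract_nonneg _) hdeg hfract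
    · refine hcontra (1 - t) (fun s => 1 - Int.fract (l s)) (by linarith) (by linarith)
        (fun s => by linarith [Int.fract_lt_one (l s)]) ?_ ?_
      · have hcardR : (T.card : ℝ) ≤ k := by
          exact_mod_cast (by omega : T.card ≤ k)
        rw [Finset.sum_sub_distrib]
        simp only [Finset.sum_const, nsmul_eq_mul, mul_one]
        linarith
      · have : (1 - t) • (m - (k : ℝ) • v) + ∑ s ∈ T, (1 - Int.fract (l s)) • (s - v) =
            (m - (k : ℝ) • v) + ∑ s ∈ T, (s - v) -
              (t • (m - (k : ℝ) • v) + ∑ s ∈ T, Int.fract (l s) • (s - v)) := by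
          simp only [sub_smul (1 : ℝ), one_smul, Finset.sum_sub_distrib]
          abel
        rw [this]
        exact (latSubgroup n).sub_mem
          ((latSubgroup n).add_mem hm'lat ((latSubgroup n).sum_mem hgen)) hfract
  · rintro _ ⟨c, ⟨hc, hclat⟩, rfl⟩
    refine ⟨?_, (latSubgroup n).add_mem hm'lat hclat⟩
    have hopen : IsOpen ((fun x => x + (c - (k : ℝ) • v)) '' interior (dilate n k P)) :=
      isOpenMap_add_right _ _ isOpen_interior
    refine interior_maximal ?_ hopen ⟨m, hmint, by dsimp only; abel⟩
    rintro _ ⟨x, hx, rfl⟩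
    have := coneAt_add_mem S hvP (hdilate x (interior_subset hx)) hc
    convert this using 1
    dsimp only
    abel

/-- A lattice 3-polytope `P` with exactly one lattice point in the interior of `2P`
is Gorenstein. -/
theorem threefold_gorenstein (P : Set (Fin 3 → ℝ))
    (hP : IsLatticePolytope 3 P)
    (hint : ∃ m₀, interior (dilate 3 2 P) ∩ lat 3 = {m₀}) :
    Gorenstein 3 P := by
  classical
  obtain ⟨⟨S, -, rfl⟩, -⟩ := hP
  obtain ⟨m, hm⟩ := hint
  rw [← Finset.coe_image] at hm ⊢
  have hlat : ∀ s ∈ S.image (fun (z : Fin 3 → ℤ) i => (z i : ℝ)), s ∈ lat 3 := by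
    intro s hs
    obtain ⟨z, -, rfl⟩ := Finset.mem_image.1 hs
    exact fun i => ⟨z i, rfl⟩
  exact fun v hv => gorensteinAt_of_unique_interior_point two_pos le_rfl _ hlat hm hv.1
    (hlat v (extremePoints_convexHull_subset hv))
end
end

section
/- Let n ≥ 4 and let P ⊆ ℝⁿ be a lattice n-polytope such that the topological interior of the dilate (n−1)P contains exactly one point of ℤⁿ. Then P is Gorenstein, i.e. it is Gorenstein at every vertex. -/
open Set Pointwise

noncomputable section

section Cone

variable {V : Type*} [AddCommGroup V] [Module ℝ V]

/-- The cone of nonnegative combinations of a finite set. -/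
def posCone (S : Finset V) : Set V :=
  {x | ∃ u : V → ℝ, (∀ s ∈ S, 0 ≤ u s) ∧ ∑ s ∈ S, u s • s = x}

/-- The set of combinations of a finite set with all coefficients positive. -/
def openCone (S : Finset V) : Set V :=
  {x | ∃ u : V → ℝ, (∀ s ∈ S, 0 < u s) ∧ ∑ s ∈ S, u s • s = x}

/-- A finite set of vectors that is a basis. -/
def IsBase (T : Finset V) : Prop :=
  LinearIndepOn ℝ id (T : Set V) ∧ Submodule.span ℝ (T : Set V) = ⊤

theorem IsBase.exists_coord {T : Finset V} (hT : IsBase T) :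
    ∃ c : V → V →ₗ[ℝ] ℝ, (∀ x, ∑ s ∈ T, c s x • s = x) ∧
      ∀ a : V → ℝ, ∀ t ∈ T, c t (∑ s ∈ T, a s • s) = a t := by
  classical
  have hli : LinearIndependent ℝ (fun s : T => (s : V)) := hT.1
  let B := Module.Basis.mk hli (by simp [hT.2])
  have hB : ∀ s : T, B s = (s : V) := fun s => by simp [B]
  refine ⟨fun s => if h : s ∈ T then B.coord ⟨s, h⟩ else 0, fun x => ?_, fun a t ht => ?_⟩
  · rw [← Finset.sum_coe_sort]
    conv_rhs => rw [← B.sum_repr x]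
    refine Finset.sum_congr rfl fun s _ => ?_
    simp [hB]
  · rw [← Finset.sum_coe_sort]
    simp only [ht, dif_pos, ← hB, map_sum, map_smul, Module.Basis.coord_apply,
      Module.Basis.repr_self, smul_eq_mul]
    rw [Finset.sum_eq_single ⟨t, ht⟩]
    · simp [hB]
    · intro b _ hb
      simp [hb]
    · simp

open Classical in
/-- The coordinates with respect to a finite set that is a basis. -/
def coord (T : Finset V) : V → V →ₗ[ℝ] ℝ :=
  if h : IsBase T then h.exists_coord.choose else 0

theorem IsBase.sum_coord {T : Finset V} (hT : IsBase T) (x : V) :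
    ∑ s ∈ T, coord T s x • s = x := by
  rw [coord, dif_pos hT]
  exact hT.exists_coord.choose_spec.1 x

theorem IsBase.coord_sum {T : Finset V} (hT : IsBase T) (a : V → ℝ) {t : V} (ht : t ∈ T) :
    coord T t (∑ s ∈ T, a s • s) = a t := by
  rw [coord, dif_pos hT]
  exact hT.exists_coord.choose_spec.2 a t ht

theorem IsBase.coord_self {T : Finset V} (hT : IsBase T) [DecidableEq V] {s t : V} (hs : s ∈ T)
    (ht : t ∈ T) : coord T t s = if s = t then 1 else 0 := by
  have h := hT.coord_sum (fun r => if s = r then 1 else 0) ht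
  simpa [ite_smul, hs] using h

theorem IsBase.card_eq {T : Finset V} (hT : IsBase T) : T.card = Module.finrank ℝ V := by
  have h := finrank_span_set_eq_card (R := ℝ) (s := (T : Set V)) hT.1
  rw [hT.2, finrank_top] at h
  simpa using h.symm

theorem isBase_of_card {T : Finset V} (hT : Submodule.span ℝ (T : Set V) = ⊤)
    (hc : T.card = Module.finrank ℝ V) : IsBase T := by
  refine ⟨?_, hT⟩
  exact linearIndependent_of_top_le_span_of_card_eq_finrank (b := fun s : (T : Set V) => (s : V))
    (by simp [hT]) (by simpa using hc)

theorem IsBase.exchange [DecidableEq V] {T : Finset V} (hT : IsBase T) {b s : V} (hb : b ∈ T)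
    (hs : s ∉ T) (hc : coord T b s ≠ 0) : IsBase (insert s (T.erase b)) := by
  refine isBase_of_card ?_ ?_
  · have hsub : ∀ r ∈ T, r ∈ Submodule.span ℝ (insert s (T.erase b) : Finset V) := by
      have key : ∀ r ∈ T.erase b, r ∈ Submodule.span ℝ (insert s (T.erase b) : Finset V) :=
        fun r hr => Submodule.subset_span (by simp [Finset.mem_erase.mp hr])
      intro r hr
      by_cases hrb : r = b
      · subst hrb
        have h := hT.sum_coord s
        rw [← Finset.add_sum_erase _ _ hb] at h
        have h2 : (coord T r s)⁻¹ • (s - ∑ x ∈ T.erase r, coord T x s • x) = r := by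
          rw [inv_smul_eq_iff₀ hc, sub_eq_iff_eq_add, h]
        have h3 : (coord T r s)⁻¹ • (s - ∑ x ∈ T.erase r, coord T x s • x) ∈
            Submodule.span ℝ (insert s (T.erase r) : Finset V) :=
          Submodule.smul_mem _ _ (Submodule.sub_mem _ (Submodule.subset_span (by simp))
            (Submodule.sum_mem _ fun x hx => Submodule.smul_mem _ _ (key x hx)))
        rwa [h2] at h3
      · exact key r (Finset.mem_erase.mpr ⟨hrb, hr⟩)
    rw [eq_top_iff, ← hT.2]
    exact Submodule.span_le.mpr fun r hr => hsub r hr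
  · rw [Finset.card_insert_of_notMem (by simp [hs]), Finset.card_erase_add_one hb, hT.card_eq]

theorem sum_exchange {ι : Type*} [DecidableEq ι] {M : Type*} [AddCommGroup M] [Module ℝ M] {T : Finset ι}
    {b s : ι} (hb : b ∈ T) (hs : s ∉ T) {c : ι → ℝ} (hc : c b = 0) (t : ℝ) (f : ι → M) :
    ∑ r ∈ insert s (T.erase b), (if r = s then t else c r) • f r =
      t • f s + ∑ r ∈ T, c r • f r := by
  rw [Finset.sum_insert (by simp [hs]), ← Finset.add_sum_erase T _ hb, hc, zero_smul, zero_add,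
    if_pos rfl]
  congr 1
  refine Finset.sum_congr rfl fun r hr => ?_
  have : r ≠ s := fun h => hs (h ▸ Finset.mem_of_mem_erase hr)
  simp [this]

theorem exists_ratio {ι : Type*} {T : Finset ι} {u g : ι → ℝ} (hu : ∀ s ∈ T, 0 ≤ u s)
    (hg : ∃ s ∈ T, 0 < g s) :
    ∃ b ∈ T, 0 < g b ∧ ∀ s ∈ T, u b / g b * g s ≤ u s := by
  classical
  obtain ⟨s₀, hs₀, hgs₀⟩ := hg
  obtain ⟨b, hb, hmin⟩ := (T.filter fun s => 0 < g s).exists_min_image (fun s => u s / g s)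
    ⟨s₀, by simp [hs₀, hgs₀]⟩
  simp only [Finset.mem_filter] at hb hmin
  refine ⟨b, hb.1, hb.2, fun s hs => ?_⟩
  by_cases h : 0 < g s
  · exact (le_div_iff₀ h).mp (hmin s ⟨hs, h⟩)
  · exact (mul_nonpos_of_nonneg_of_nonpos (div_nonneg (hu b hb.1) hb.2.le) (not_lt.mp h)).trans
      (hu s hs)

theorem posCone_mono {S T : Finset V} (h : T ⊆ S) : posCone T ⊆ posCone S := by
  classical
  rintro x ⟨u, hu, rfl⟩
  refine ⟨fun s => if s ∈ T then u s else 0, fun s _ => ?_, ?_⟩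
  · dsimp only
    split_ifs with hs
    exacts [hu s hs, le_rfl]
  · simp only [ite_smul, zero_smul]
    rw [Finset.sum_ite_mem, Finset.inter_eq_right.mpr h]

theorem add_mem_posCone {S : Finset V} {x y : V} (hx : x ∈ posCone S) (hy : y ∈ posCone S) :
    x + y ∈ posCone S := by
  obtain ⟨u, hu, rfl⟩ := hx
  obtain ⟨w, hw, rfl⟩ := hy
  exact ⟨u + w, fun s hs => add_nonneg (hu s hs) (hw s hs), by
    simp [add_smul, Finset.sum_add_distrib]⟩

theorem smul_mem_posCone {S : Finset V} {x : V} (hx : x ∈ posCone S) {r : ℝ} (hr : 0 ≤ r) :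
    r • x ∈ posCone S := by
  obtain ⟨u, hu, rfl⟩ := hx
  exact ⟨r • u, fun s hs => mul_nonneg hr (hu s hs), by simp [Finset.smul_sum, mul_smul]⟩

theorem mem_posCone_of_mem {S : Finset V} {s : V} (hs : s ∈ S) : s ∈ posCone S := by
  classical
  exact ⟨fun r => if s = r then 1 else 0, fun r _ => by dsimp only; split_ifs <;> simp,
    by simp [ite_smul, hs]⟩

theorem add_mem_openCone {S : Finset V} {x y : V} (hx : x ∈ openCone S) (hy : y ∈ posCone S) :
    x + y ∈ openCone S := by
  obtain ⟨u, hu, rfl⟩ := hx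
  obtain ⟨w, hw, rfl⟩ := hy
  exact ⟨u + w, fun s hs => add_pos_of_pos_of_nonneg (hu s hs) (hw s hs), by
    simp [add_smul, Finset.sum_add_distrib]⟩

theorem smul_mem_openCone {S : Finset V} {x : V} (hx : x ∈ openCone S) {r : ℝ} (hr : 0 < r) :
    r • x ∈ openCone S := by
  obtain ⟨u, hu, rfl⟩ := hx
  exact ⟨r • u, fun s hs => mul_pos hr (hu s hs), by simp [Finset.smul_sum, mul_smul]⟩

theorem openCone_subset_posCone (S : Finset V) : openCone S ⊆ posCone S := by
  rintro x ⟨u, hu, rfl⟩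
  exact ⟨u, fun s hs => (hu s hs).le, rfl⟩

/-- Carathéodory's theorem for cones. -/
theorem exists_linearIndepOn_of_mem_posCone (S : Finset V) {x : V} (hx : x ∈ posCone S) :
    ∃ T ⊆ S, LinearIndepOn ℝ id (T : Set V) ∧ x ∈ posCone T := by
  classical
  induction S using Finset.strongInduction with
  | H S ih =>
    by_cases hS : LinearIndepOn ℝ id (S : Set V)
    · exact ⟨S, subset_rfl, hS, hx⟩
    · obtain ⟨g, hg0, s₀, hs₀, hgs₀⟩ : ∃ g : V → ℝ, ∑ s ∈ S, g s • s = 0 ∧ ∃ s ∈ S, g s ≠ 0 := by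
        rw [linearIndepOn_finset_iff] at hS
        push Not at hS
        simpa using hS
      obtain ⟨g, hg0, hpos⟩ : ∃ g : V → ℝ, ∑ s ∈ S, g s • s = 0 ∧ ∃ s ∈ S, 0 < g s := by
        rcases lt_or_gt_of_ne hgs₀ with h | h
        · exact ⟨-g, by simp [hg0], s₀, hs₀, by simpa using h⟩
        · exact ⟨g, hg0, s₀, hs₀, h⟩
      obtain ⟨u, hu, rfl⟩ := hx
      obtain ⟨b, hb, hgb, hle⟩ := exists_ratio hu hpos
      obtain ⟨T, hT, h⟩ := ih (S.erase b) (Finset.erase_ssubset hb)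
        ⟨fun s => u s - u b / g b * g s, fun s hs => sub_nonneg.mpr
          (hle s (Finset.mem_of_mem_erase hs)), by
          rw [← Finset.sum_erase_add S _ hb] at hg0
          rw [← Finset.sum_erase_add S _ hb]
          simp only [sub_smul, mul_smul, Finset.sum_sub_distrib, ← Finset.smul_sum]
          rw [eq_neg_of_add_eq_zero_left hg0, smul_neg, smul_smul, div_mul_cancel₀ _ hgb.ne',
            sub_neg_eq_add]⟩
      exact ⟨T, hT.trans (Finset.erase_subset _ _), h⟩

theorem exists_isBase_of_mem_posCone {S : Finset V} (hS : Submodule.span ℝ (S : Set V) = ⊤) {x : V}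
    (hx : x ∈ posCone S) : ∃ T ⊆ S, IsBase T ∧ ∀ s ∈ T, 0 ≤ coord T s x := by
  classical
  obtain ⟨T, hTS, hli, hxT⟩ := exists_linearIndepOn_of_mem_posCone S hx
  obtain ⟨b, hbS, hTb, hspan, hb⟩ := exists_linearIndepOn_extension hli (Finset.coe_subset.mpr hTS)
  lift b to Finset V using S.finite_toSet.subset hbS
  have hbase : IsBase b := ⟨hb, by
    rw [eq_top_iff, ← hS]
    exact Submodule.span_le.mpr (by simpa using hspan)⟩
  obtain ⟨u, hu, rfl⟩ := posCone_mono (Finset.coe_subset.mp hTb) hxT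
  exact ⟨b, Finset.coe_subset.mp hbS, hbase, fun s hs => by rw [hbase.coord_sum u hs]; exact hu s hs⟩

/-- The linear functional that agrees with `ω` on the basis `T`. -/
def interp (ω : V → ℝ) (T : Finset V) : V →ₗ[ℝ] ℝ := ∑ b ∈ T, ω b • coord T b

theorem interp_apply (ω : V → ℝ) (T : Finset V) (x : V) :
    interp ω T x = ∑ b ∈ T, coord T b x * ω b := by
  simp [interp, mul_comm]

theorem IsBase.interp_sum {T : Finset V} (hT : IsBase T) (ω a : V → ℝ) :
    interp ω T (∑ s ∈ T, a s • s) = ∑ s ∈ T, a s * ω s := by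
  rw [interp_apply]
  exact Finset.sum_congr rfl fun s hs => by rw [hT.coord_sum a hs]

theorem IsBase.interp_self {T : Finset V} (hT : IsBase T) (ω : V → ℝ) {s : V} (hs : s ∈ T) :
    interp ω T s = ω s := by
  classical
  have h := hT.interp_sum ω (fun r => if s = r then 1 else 0)
  simpa [ite_smul, hs] using h

/-- The bases in `S` that span the cells of the regular subdivision given by the heights `ω`. -/
def IsLower (S : Finset V) (ω : V → ℝ) (T : Finset V) : Prop :=
  T ⊆ S ∧ IsBase T ∧ ∀ s ∈ S, s ∉ T → interp ω T s < ω s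

/-- A vector none of whose coordinates with respect to the bases in `S` vanishes. -/
def IsGeneric (S : Finset V) (p : V) : Prop :=
  ∀ T ⊆ S, IsBase T → ∀ s ∈ T, coord T s p ≠ 0

theorem exists_isLower {S : Finset V} (hS : Submodule.span ℝ (S : Set V) = ⊤) {h : V →ₗ[ℝ] ℝ}
    (hh : ∀ s ∈ S, h s = 1) {ω : V → ℝ}
    (hω : ∀ T ⊆ S, IsBase T → ∀ s ∈ S, s ∉ T → interp ω T s ≠ ω s) {x : V}
    (hx : x ∈ posCone S) (hgen : IsGeneric S x) :
    ∃ T, IsLower S ω T ∧ ∀ s ∈ T, 0 < coord T s x := by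
  classical
  obtain ⟨T₀, hT₀⟩ := exists_isBase_of_mem_posCone hS hx
  obtain ⟨T, hT, hmin⟩ := (S.powerset.filter fun T => IsBase T ∧ ∀ s ∈ T, 0 ≤ coord T s x).exists_min_image
    (fun T => interp ω T x) ⟨T₀, by simpa using hT₀⟩
  simp only [Finset.mem_filter, Finset.mem_powerset] at hT hmin
  obtain ⟨hTS, hT, hpos⟩ := hT
  have hpos' : ∀ s ∈ T, 0 < coord T s x := fun s hs => (hpos s hs).lt_of_ne' (hgen T hTS hT s hs)
  refine ⟨T, ⟨hTS, hT, fun s hs hsT => (hω T hTS hT s hs hsT).lt_of_le ?_⟩, hpos'⟩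
  by_contra! hlt
  have hone : ∑ b ∈ T, coord T b s = 1 := by
    have h1 := congrArg h (hT.sum_coord s)
    rw [map_sum, hh s hs] at h1
    rw [← h1]
    exact Finset.sum_congr rfl fun b hb => by simp [hh b (hTS hb)]
  obtain ⟨b, hb, hgb, hle⟩ := exists_ratio hpos
    (Finset.exists_lt_of_sum_lt (s := T) (f := 0) (g := fun b => coord T b s) (by simp [hone]))
  set t := coord T b x / coord T b s with ht
  have ht0 : 0 < t := div_pos (hpos' b hb) hgb
  have hT' := hT.exchange hb hsT hgb.ne'
  set T' := insert s (T.erase b) with hT'def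
  let a : V → ℝ := fun r => if r = s then t else coord T r x - t * coord T r s
  have hab : coord T b x - t * coord T b s = 0 := by
    rw [ht, div_mul_cancel₀ _ hgb.ne', sub_self]
  have hxa : ∑ r ∈ T', a r • r = x := by
    rw [sum_exchange hb hsT (c := fun r => coord T r x - t * coord T r s) hab t fun r => r]
    simp only [sub_smul, mul_smul, Finset.sum_sub_distrib, ← Finset.smul_sum, hT.sum_coord]
    abel
  have hle' := hmin T' ⟨?_, hT', fun r hr => ?_⟩
  · rw [← hxa, hT'.interp_sum, hxa] at hle'
    have := sum_exchange hb hsT (c := fun r => coord T r x - t * coord T r s) hab t ω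
    simp only [smul_eq_mul] at this
    rw [this] at hle'
    simp only [sub_mul, mul_assoc, Finset.sum_sub_distrib, ← Finset.mul_sum, ← interp_apply] at hle'
    nlinarith
  · exact Finset.insert_subset hs ((Finset.erase_subset _ _).trans hTS)
  · rw [← hxa, hT'.coord_sum a hr]
    simp only [a]
    split_ifs with hrs
    · exact ht0.le
    · rcases Finset.mem_insert.mp hr with h | h
      · exact absurd h hrs
      · exact sub_nonneg.mpr (hle r (Finset.mem_of_mem_erase h))

theorem IsLower.interp_le {S T T' : Finset V} {ω : V → ℝ} (hT : IsLower S ω T)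
    (hT' : IsLower S ω T') {x : V} (hx : ∀ s ∈ T, 0 < coord T s x) :
    interp ω T' x ≤ interp ω T x ∧ (¬ T ⊆ T' → interp ω T' x < interp ω T x) := by
  have hle : ∀ s ∈ S, interp ω T' s ≤ ω s := fun s hs => by
    by_cases h : s ∈ T'
    · exact (hT'.2.1.interp_self ω h).le
    · exact (hT'.2.2 s hs h).le
  have h1 : interp ω T' x = ∑ s ∈ T, coord T s x * interp ω T' s := by
    conv_lhs => rw [← hT.2.1.sum_coord x]
    simp
  rw [h1, interp_apply ω T x]
  refine ⟨Finset.sum_le_sum fun s hs => mul_le_mul_of_nonneg_left (hle s (hT.1 hs)) (hx s hs).le,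
    fun hsub => ?_⟩
  obtain ⟨s, hs, hs'⟩ := Finset.not_subset.mp hsub
  exact Finset.sum_lt_sum
    (fun s hs => mul_le_mul_of_nonneg_left (hle s (hT.1 hs)) (hx s hs).le)
    ⟨s, hs, mul_lt_mul_of_pos_left (hT'.2.2 s (hT.1 hs) hs') (hx s hs)⟩

theorem IsLower.unique {S T T' : Finset V} {ω : V → ℝ} (hT : IsLower S ω T)
    (hT' : IsLower S ω T') {x : V} (hx : ∀ s ∈ T, 0 < coord T s x)
    (hx' : ∀ s ∈ T', 0 < coord T' s x) : T = T' := by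
  have h1 := hT.interp_le hT' hx
  have h2 := hT'.interp_le hT hx'
  refine Finset.Subset.antisymm ?_ ?_
  · by_contra h
    exact absurd (h1.2 h) (not_lt.mpr h2.1)
  · by_contra h
    exact absurd (h2.2 h) (not_lt.mpr h1.1)

/-- Positivity of `c + ε * p` for all small `ε > 0`. -/
def IsPosAlong (p c : ℝ) : Prop := 0 < c ∨ (c = 0 ∧ 0 < p)

theorem IsPosAlong.mono {p c c' : ℝ} (h : IsPosAlong p c) (hc : c ≤ c') : IsPosAlong p c' := by
  unfold IsPosAlong at *
  grind

theorem IsPosAlong.nonneg {p c : ℝ} (h : IsPosAlong p c) : 0 ≤ c := by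
  unfold IsPosAlong at *
  grind

theorem isPosAlong_neg {p : ℝ} (hp : p ≠ 0) (c : ℝ) : IsPosAlong (-p) (-c) ↔ ¬ IsPosAlong p c := by
  unfold IsPosAlong
  grind

theorem eventually_isPosAlong {p : ℝ} (hp : p ≠ 0) (c : ℝ) :
    ∀ᶠ ε : ℝ in nhdsWithin 0 (Ioi 0), (0 < c + ε * p ↔ IsPosAlong p c) ∧ c + ε * p ≠ 0 := by
  rcases lt_trichotomy c 0 with hc | rfl | hc
  · have ht : Filter.Tendsto (fun ε : ℝ => c + ε * p) (nhdsWithin 0 (Ioi 0)) (nhds c) := by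
      have : Continuous fun ε : ℝ => c + ε * p := by fun_prop
      simpa using (this.tendsto 0).mono_left nhdsWithin_le_nhds
    filter_upwards [ht.eventually_lt_const hc] with ε hε
    unfold IsPosAlong
    grind
  · filter_upwards [self_mem_nhdsWithin] with ε hε
    have hε' : (0 : ℝ) < ε := hε
    simp [IsPosAlong, hε', hε'.ne', hp]
  · have ht : Filter.Tendsto (fun ε : ℝ => c + ε * p) (nhdsWithin 0 (Ioi 0)) (nhds c) := by
      have : Continuous fun ε : ℝ => c + ε * p := by fun_prop
      simpa using (this.tendsto 0).mono_left nhdsWithin_le_nhds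
    filter_upwards [ht.eventually_const_lt hc] with ε hε
    unfold IsPosAlong
    grind

theorem exists_isPosAlong_sub_nat {p c : ℝ} (h : IsPosAlong p c) :
    ∃ a : ℕ, IsPosAlong p (c - a) ∧ ¬ IsPosAlong p (c - a - 1) := by
  classical
  have hex : ∃ k : ℕ, ¬ IsPosAlong p (c - k) := by
    obtain ⟨k, hk⟩ := exists_nat_gt c
    exact ⟨k, fun h => by have := h.nonneg; linarith⟩
  have hspec := Nat.find_spec hex
  have hne : Nat.find hex ≠ 0 := fun h0 => by
    rw [h0] at hspec
    simp [h] at hspec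
  obtain ⟨a, ha⟩ := Nat.exists_eq_succ_of_ne_zero hne
  refine ⟨a, not_not.mp (Nat.find_min hex (m := a) (by omega)), ?_⟩
  rw [ha] at hspec
  push_cast at hspec
  rwa [sub_sub]

theorem nat_le_of_isPosAlong {p c c' : ℝ} {a b : ℕ} (h : c + a = c' + b)
    (hc : ¬ IsPosAlong p (c - 1)) (hc' : IsPosAlong p c') : b ≤ a := by
  by_contra! hlt
  refine hc (hc'.mono ?_)
  have : (a : ℝ) + 1 ≤ b := by exact_mod_cast hlt
  linarith

/-- The cell of the basis `T`, shifted infinitesimally along `p`. -/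
def InCell (T : Finset V) (p x : V) : Prop := ∀ s ∈ T, IsPosAlong (coord T s p) (coord T s x)

/-- The half-open parallelepiped of the basis `T`, with sides chosen according to `p`. -/
def InBox (T : Finset V) (p x : V) : Prop :=
  ∀ s ∈ T, IsPosAlong (coord T s p) (coord T s x) ∧
    ¬ IsPosAlong (coord T s p) (coord T s x - 1)

theorem eventually_coord (S : Finset V) {p : V} (hp : IsGeneric S p) (x : V) :
    ∀ᶠ ε : ℝ in nhdsWithin 0 (Ioi 0), ∀ T ⊆ S, IsBase T → ∀ s ∈ T,
      (0 < coord T s (x + ε • p) ↔ IsPosAlong (coord T s p) (coord T s x)) ∧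
        coord T s (x + ε • p) ≠ 0 := by
  have h : ∀ T ∈ S.powerset, ∀ᶠ ε : ℝ in nhdsWithin 0 (Ioi 0), IsBase T → ∀ s ∈ T,
      (0 < coord T s (x + ε • p) ↔ IsPosAlong (coord T s p) (coord T s x)) ∧
        coord T s (x + ε • p) ≠ 0 := by
    intro T hT
    by_cases hb : IsBase T
    · have := (Filter.eventually_all_finset T).mpr fun s hs =>
        eventually_isPosAlong (hp T (Finset.mem_powerset.mp hT) hb s hs) (coord T s x)
      filter_upwards [this] with ε hε _ s hs
      simpa using hε s hs
    · simp [hb]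
  filter_upwards [(Filter.eventually_all_finset S.powerset).mpr h] with ε hε T hT
  exact hε T (Finset.mem_powerset.mpr hT)

/-- Lattice points `L` graded by `h`, a set `S` of lattice points at height one, and heights `ω` that
define a regular triangulation of `S`. -/
structure IsTriangulated (S : Finset V) (h : V →ₗ[ℝ] ℝ) (L : AddSubgroup V) (ω : V → ℝ) :
    Prop where
  span_eq : Submodule.span ℝ (S : Set V) = ⊤
  height : ∀ s ∈ S, h s = 1
  int_height : ∀ x ∈ L, h x = (⌊h x⌋ : ℝ)
  mem : ∀ s ∈ S, s ∈ L
  finite : ∀ R : ℝ, {x | x ∈ L ∧ x ∈ posCone S ∧ h x ≤ R}.Finite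
  interp_ne : ∀ T ⊆ S, IsBase T → ∀ s ∈ S, s ∉ T → interp ω T s ≠ ω s

namespace IsTriangulated

variable {S : Finset V} {h : V →ₗ[ℝ] ℝ} {L : AddSubgroup V} {ω : V → ℝ} {p : V}

theorem exists_inCell (H : IsTriangulated S h L ω) (hp : IsGeneric S p) {x : V}
    (hx : ∀ᶠ ε : ℝ in nhdsWithin 0 (Ioi 0), x + ε • p ∈ posCone S) :
    ∃ T, IsLower S ω T ∧ InCell T p x := by
  obtain ⟨ε, h1, h2⟩ := (hx.and (eventually_coord S hp x)).exists
  obtain ⟨T, hT, hpos⟩ := exists_isLower H.span_eq H.height H.interp_ne h1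
    fun T hT hb s hs => (h2 T hT hb s hs).2
  exact ⟨T, hT, fun s hs => (h2 T hT.1 hT.2.1 s hs).1.mp (hpos s hs)⟩

omit h L in
theorem inCell_unique (hp : IsGeneric S p) {x : V} {T T' : Finset V} (hT : IsLower S ω T)
    (hT' : IsLower S ω T') (hx : InCell T p x) (hx' : InCell T' p x) : T = T' := by
  obtain ⟨ε, h2⟩ := (eventually_coord S hp x).exists
  exact hT.unique hT' (fun s hs => (h2 T hT.1 hT.2.1 s hs).1.mpr (hx s hs))
    fun s hs => (h2 T' hT'.1 hT'.2.1 s hs).1.mpr (hx' s hs)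

end IsTriangulated

theorem mem_posCone_of_coord_nonneg {S T : Finset V} (hTS : T ⊆ S) (hT : IsBase T) {x : V}
    (hx : ∀ s ∈ T, 0 ≤ coord T s x) : x ∈ posCone S :=
  posCone_mono hTS ⟨fun s => coord T s x, hx, hT.sum_coord x⟩

theorem eventually_mem_posCone_of_inCell {S T : Finset V} (hTS : T ⊆ S) (hT : IsBase T) {p x : V}
    (hp : IsGeneric S p) (hx : InCell T p x) :
    ∀ᶠ ε : ℝ in nhdsWithin 0 (Ioi 0), x + ε • p ∈ posCone S := by
  filter_upwards [eventually_coord S hp x] with ε hε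
  exact mem_posCone_of_coord_nonneg hTS hT fun s hs => ((hε T hTS hT s hs).1.mpr (hx s hs)).le

theorem IsBase.height_eq {S T : Finset V} (hT : IsBase T) (hTS : T ⊆ S) {h : V →ₗ[ℝ] ℝ}
    (hh : ∀ s ∈ S, h s = 1) (x : V) : h x = ∑ s ∈ T, coord T s x := by
  conv_lhs => rw [← hT.sum_coord x, map_sum]
  exact Finset.sum_congr rfl fun s hs => by simp [hh s (hTS hs)]

open Classical in
/-- The vectors of natural numbers supported on `T` with sum `j`. -/
def comps {ι : Type*} (T : Finset ι) (j : ℤ) : Finset (ι →₀ ℕ) :=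
  if 0 ≤ j then T.finsuppAntidiag j.toNat else ∅

theorem mem_comps {ι : Type*} {T : Finset ι} {j : ℤ} {a : ι →₀ ℕ} :
    a ∈ comps T j ↔ ∑ s ∈ T, (a s : ℤ) = j ∧ a.support ⊆ T := by
  classical
  unfold comps
  split_ifs with hj
  · rw [Finset.mem_finsuppAntidiag]
    refine and_congr_left fun _ => ?_
    rw [← Nat.cast_sum]
    change ∑ s ∈ T, a s = _ ↔ _
    omega
  · simp only [Finset.notMem_empty, false_iff, not_and]
    rintro rfl
    exact absurd (Finset.sum_nonneg fun s _ => by positivity) hj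

/-- The number of vectors of `d` natural numbers with sum `j`. -/
def numComps (d : ℕ) (j : ℤ) : ℕ := if 0 ≤ j then d.multichoose j.toNat else 0

theorem card_comps {ι : Type*} (T : Finset ι) (j : ℤ) :
    (comps T j).card = numComps T.card j := by
  classical
  unfold comps numComps
  split_ifs
  · exact Finset.card_finsuppAntidiag_nat_eq_multichoose _
  · rfl

namespace IsTriangulated

variable {S : Finset V} {h : V →ₗ[ℝ] ℝ} {L : AddSubgroup V} {ω : V → ℝ} {p : V}

theorem finite_boxes (H : IsTriangulated S h L ω) (p : V) :
    {i : Finset V × V | IsLower S ω i.1 ∧ i.2 ∈ L ∧ InBox i.1 p i.2}.Finite := by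
  refine (S.powerset.finite_toSet.prod (H.finite (Module.finrank ℝ V))).subset ?_
  rintro ⟨T, x⟩ ⟨hT, hxL, hx⟩
  refine ⟨by simpa using hT.1, hxL,
    mem_posCone_of_coord_nonneg hT.1 hT.2.1 fun s hs => (hx s hs).1.nonneg, ?_⟩
  rw [hT.2.1.height_eq hT.1 H.height, ← hT.2.1.card_eq, Finset.cast_card]
  refine Finset.sum_le_sum fun s hs => ?_
  by_contra! hlt
  exact (hx s hs).2 (Or.inl (by linarith))

/-- The lattice points in the boxes of the triangulation. -/
def boxes (H : IsTriangulated S h L ω) (p : V) : Finset (Finset V × V) :=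
  (H.finite_boxes p).toFinset

theorem mem_boxes (H : IsTriangulated S h L ω) (p : V) {i : Finset V × V} :
    i ∈ H.boxes p ↔ IsLower S ω i.1 ∧ i.2 ∈ L ∧ InBox i.1 p i.2 := by
  simp [boxes]

theorem ncard_eq_sum_boxes (H : IsTriangulated S h L ω) (hp : IsGeneric S p) {K : Set V}
    (hK : ∀ x, x ∈ K ↔ ∃ T, IsLower S ω T ∧ InCell T p x) (k : ℤ) :
    {x | x ∈ L ∧ x ∈ K ∧ h x = k}.ncard =
      ∑ i ∈ H.boxes p, numComps (Module.finrank ℝ V) (k - ⌊h i.2⌋) := by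
  classical
  have hcoord : ∀ {T : Finset V} (hT : IsBase T) (y : V) (a : V → ℕ), ∀ s ∈ T,
      coord T s (y + ∑ s ∈ T, (a s : ℝ) • s) = coord T s y + a s := fun {T} hT y a s hs => by
    rw [map_add, hT.coord_sum (fun s => (a s : ℝ)) hs]
  have hheight : ∀ {T : Finset V} (hT : T ⊆ S) (y : V) (a : V → ℕ),
      h (y + ∑ s ∈ T, (a s : ℝ) • s) = h y + ((∑ s ∈ T, (a s : ℤ) : ℤ) : ℝ) :=
    fun {T} hT y a => by
      rw [map_add, map_sum]
      push_cast
      congr 1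
      exact Finset.sum_congr rfl fun s hs => by simp [H.height s (hT hs)]
  have hmem : ∀ {T : Finset V} (hT : T ⊆ S) (a : V → ℕ), ∑ s ∈ T, (a s : ℝ) • s ∈ L :=
    fun {T} hT a => L.sum_mem fun s hs => by
      rw [Nat.cast_smul_eq_nsmul]
      exact L.nsmul_mem (H.mem s (hT hs)) _
  have hsum : ∑ i ∈ H.boxes p, numComps (Module.finrank ℝ V) (k - ⌊h i.2⌋) =
      ((H.boxes p).sigma fun i => comps i.1 (k - ⌊h i.2⌋)).card := by
    rw [Finset.card_sigma]
    refine Finset.sum_congr rfl fun i hi => ?_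
    rw [card_comps, ((H.mem_boxes p).mp hi).1.2.1.card_eq]
  rw [hsum, ← Set.ncard_coe_finset, eq_comm]
  have himg : {x | x ∈ L ∧ x ∈ K ∧ h x = k} =
      (fun j : (_ : Finset V × V) × (V →₀ ℕ) => j.1.2 + ∑ s ∈ j.1.1, (j.2 s : ℝ) • s) ''
        ((H.boxes p).sigma fun i => comps i.1 (k - ⌊h i.2⌋) : Finset _) := by
    ext x
    simp only [Set.mem_ofPred_eq, Set.mem_image, Finset.mem_coe, Finset.mem_sigma, mem_boxes,
      mem_comps]
    constructor
    · rintro ⟨hxL, hxK, hxk⟩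
      obtain ⟨T, hT, hx⟩ := (hK x).mp hxK
      choose! a ha using fun s hs => exists_isPosAlong_sub_nat (hx s hs)
      let a' : V →₀ ℕ := Finsupp.onFinset T (fun s => if s ∈ T then a s else 0) fun s hs => by
        by_contra h
        simp [h] at hs
      have ha' : ∀ s ∈ T, a' s = a s := fun s hs => by simp [a', hs]
      have hx' : x - ∑ s ∈ T, (a' s : ℝ) • s + ∑ s ∈ T, (a' s : ℝ) • s = x := sub_add_cancel _ _
      have hyL : x - ∑ s ∈ T, (a' s : ℝ) • s ∈ L := L.sub_mem hxL (hmem hT.1 _)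
      refine ⟨⟨(T, x - ∑ s ∈ T, (a' s : ℝ) • s), a'⟩, ⟨⟨hT, hyL, fun s hs => ?_⟩, ?_, ?_⟩, hx'⟩
      · have h1 := hcoord hT.2.1 (x - ∑ s ∈ T, (a' s : ℝ) • s) a' s hs
        rw [hx', ha' s hs] at h1
        rw [show coord T s (x - ∑ s ∈ T, (a' s : ℝ) • s) = coord T s x - a s by linarith]
        exact ha s hs
      · have h1 := hheight hT.1 (x - ∑ s ∈ T, (a' s : ℝ) • s) a'
        rw [hx', hxk, H.int_height _ hyL] at h1
        have h2 : k = ⌊h (x - ∑ s ∈ T, (a' s : ℝ) • s)⌋ + ∑ s ∈ T, (a' s : ℤ) := by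
          exact_mod_cast h1
        dsimp only
        omega
      · intro s hs
        by_contra h
        simp [a', h] at hs
    · rintro ⟨⟨⟨T, y⟩, a⟩, ⟨⟨hT, hyL, hy⟩, hak, -⟩, rfl⟩
      dsimp only at *
      refine ⟨L.add_mem hyL (hmem hT.1 _), (hK _).mpr ⟨T, hT, fun s hs => ?_⟩, ?_⟩
      · rw [hcoord hT.2.1 y a s hs]
        exact (hy s hs).1.mono (by simp)
      · rw [hheight hT.1, H.int_height _ hyL, hak]
        push_cast
        ring
  rw [himg]
  refine (Set.InjOn.ncard_image ?_).symm
  rintro ⟨⟨T, y⟩, a⟩ hi ⟨⟨T', y'⟩, a'⟩ hi' heq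
  simp only [Finset.mem_coe, Finset.mem_sigma, mem_boxes, mem_comps] at hi hi' heq
  obtain ⟨⟨hT, hyL, hy⟩, hak, hsup⟩ := hi
  obtain ⟨⟨hT', hyL', hy'⟩, hak', hsup'⟩ := hi'
  obtain rfl : T = T' := by
    refine inCell_unique hp hT hT' (x := y + ∑ s ∈ T, (a s : ℝ) • s) (fun s hs => ?_)
      fun s hs => ?_
    · rw [hcoord hT.2.1 y a s hs]
      exact (hy s hs).1.mono (by simp)
    · rw [heq, hcoord hT'.2.1 y' a' s hs]
      exact (hy' s hs).1.mono (by simp)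
  obtain rfl : a = a' := by
    ext s
    by_cases hs : s ∈ T
    · have h1 := hcoord hT.2.1 y a s hs
      rw [heq, hcoord hT.2.1 y' a' s hs] at h1
      exact le_antisymm (nat_le_of_isPosAlong h1 (hy' s hs).2 (hy s hs).1)
        (nat_le_of_isPosAlong h1.symm (hy s hs).2 (hy' s hs).1)
    · rw [Finsupp.notMem_support_iff.mp fun h => hs (hsup h),
        Finsupp.notMem_support_iff.mp fun h => hs (hsup' h)]
  obtain rfl : y = y' := add_right_cancel heq
  rfl

omit h L ω in
theorem _root_.InBox.reflect {T : Finset V} (hT : IsBase T) (hp : ∀ s ∈ T, coord T s p ≠ 0) {x : V}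
    (hx : InBox T p x) : InBox T (-p) (∑ s ∈ T, s - x) := by
  have h1 : ∀ s ∈ T, coord T s (∑ s ∈ T, s - x) = 1 - coord T s x := fun s hs => by
    rw [map_sub]
    congr 1
    simpa using hT.coord_sum (fun _ => 1) hs
  intro s hs
  rw [h1 s hs, map_neg, show 1 - coord T s x = -(coord T s x - 1) by ring,
    show -(coord T s x - 1) - 1 = -coord T s x by ring, isPosAlong_neg (hp s hs),
    isPosAlong_neg (hp s hs), not_not]
  exact (hx s hs).symm

omit h L ω in
theorem _root_.IsGeneric.neg (hp : IsGeneric S p) : IsGeneric S (-p) := fun T hT hb s hs => by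
  simpa using hp T hT hb s hs

theorem sum_boxes_neg (H : IsTriangulated S h L ω) (hp : IsGeneric S p) (F : ℤ → ℕ) :
    ∑ i ∈ H.boxes (-p), F ⌊h i.2⌋ = ∑ i ∈ H.boxes p, F (Module.finrank ℝ V - ⌊h i.2⌋) := by
  have key : ∀ {p : V}, IsGeneric S p → ∀ i ∈ H.boxes p,
      (i.1, ∑ s ∈ i.1, s - i.2) ∈ H.boxes (-p) := by
    intro p hp i hi
    rw [mem_boxes] at hi ⊢
    exact ⟨hi.1, L.sub_mem (L.sum_mem fun s hs => H.mem s (hi.1.1 hs)) hi.2.1,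
      hi.2.2.reflect hi.1.2.1 (hp _ hi.1.1 hi.1.2.1)⟩
  refine Finset.sum_bij' (fun i _ => (i.1, ∑ s ∈ i.1, s - i.2)) (fun i _ => (i.1, ∑ s ∈ i.1, s - i.2))
    (fun i hi => by simpa using key hp.neg i hi) (fun i hi => key hp i hi) ?_ ?_ ?_
  · simp
  · simp
  · intro i hi
    rw [mem_boxes] at hi
    congr 1
    have h1 : h (∑ s ∈ i.1, s - i.2) = ((Module.finrank ℝ V - ⌊h i.2⌋ : ℤ) : ℝ) := by
      rw [map_sub, map_sum, Finset.sum_congr rfl fun s hs => H.height s (hi.1.1 hs),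
        Finset.sum_const, hi.1.2.1.card_eq, H.int_height _ hi.2.1]
      simp
    rw [h1, Int.floor_intCast]
    omega

end IsTriangulated

omit [AddCommGroup V] [Module ℝ V] in
theorem exists_pos_weights (S : Finset V) {A : Set (V → ℝ)} (hA : A.Finite)
    (hne : ∀ a ∈ A, ∃ s ∈ S, a s ≠ 0) :
    ∃ w : V → ℝ, (∀ s, 0 < w s) ∧ ∀ a ∈ A, ∑ s ∈ S, a s * w s ≠ 0 := by
  obtain ⟨e, he⟩ := Set.countable_iff_exists_injOn.mp S.countable_toSet
  let P : (V → ℝ) → Polynomial ℝ := fun a => ∑ s ∈ S, Polynomial.C (a s) * Polynomial.X ^ e s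
  have hP : ∀ a ∈ A, P a ≠ 0 := by
    intro a ha h0
    obtain ⟨s, hs, has⟩ := hne a ha
    apply has
    have h1 := congrArg (fun Q => Polynomial.coeff Q (e s)) h0
    simp only [P, Polynomial.finsetSum_coeff, Polynomial.coeff_C_mul, Polynomial.coeff_X_pow,
      Polynomial.coeff_zero] at h1
    rw [Finset.sum_eq_single s] at h1
    · simpa using h1
    · intro r hr hrs
      rw [if_neg fun h => hrs (he hr hs h.symm), mul_zero]
    · exact fun h => absurd hs h
  have hfin : (⋃ a ∈ A, {t | (P a).IsRoot t}).Finite :=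
    hA.biUnion fun a ha => Polynomial.finite_setOfPred_isRoot (hP a ha)
  obtain ⟨t, ht, hroot⟩ := ((Set.Ioi_infinite (0 : ℝ)).sdiff hfin).nonempty
  refine ⟨fun s => t ^ e s, fun s => pow_pos ht _, fun a ha h0 => hroot ?_⟩
  simp only [Set.mem_iUnion]
  refine ⟨a, ha, ?_⟩
  change (P a).eval t = 0
  simpa [P, Polynomial.eval_finsetSum] using h0

theorem exists_isGeneric (S : Finset V) :
    ∃ w : V → ℝ, (∀ s, 0 < w s) ∧ IsGeneric S (∑ s ∈ S, w s • s) ∧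
      ∀ T ⊆ S, IsBase T → ∀ s ∈ S, s ∉ T → interp w T s ≠ w s := by
  classical
  let A₁ : Set (V → ℝ) := (fun i : Finset V × V => fun s => coord i.1 i.2 s) ''
    {i | i.1 ⊆ S ∧ i.2 ∈ i.1 ∧ IsBase i.1}
  let A₂ : Set (V → ℝ) := (fun i : Finset V × V => fun r =>
    (if r = i.2 then 1 else 0) - (if r ∈ i.1 then coord i.1 r i.2 else 0)) ''
    {i | i.1 ⊆ S ∧ i.2 ∈ S ∧ i.2 ∉ i.1}
  have hprod := S.powerset.finite_toSet.prod S.finite_toSet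
  have h₁ : A₁.Finite := (hprod.subset fun i hi =>
    ⟨by simpa using hi.1, by simpa using hi.1 hi.2.1⟩).image _
  have h₂ : A₂.Finite := (hprod.subset fun i hi =>
    ⟨by simpa using hi.1, by simpa using hi.2.1⟩).image _
  obtain ⟨w, hw, hA⟩ := exists_pos_weights S (h₁.union h₂) (by
    rintro a (⟨⟨T, t⟩, ⟨hTS, ht, hT⟩, rfl⟩ | ⟨⟨T, s⟩, ⟨hTS, hs, hsT⟩, rfl⟩)
    · exact ⟨t, hTS ht, by simp [hT.coord_self ht ht]⟩
    · exact ⟨s, hs, by simp [show s ∉ T from hsT]⟩)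
  refine ⟨w, hw, fun T hT hb t ht h0 => ?_, fun T hT hb s hs hsT h0 => ?_⟩
  · refine hA _ (Or.inl ⟨(T, t), ⟨hT, ht, hb⟩, rfl⟩) ?_
    rw [← h0, map_sum]
    exact Finset.sum_congr rfl fun s _ => by simp [mul_comm]
  · refine hA _ (Or.inr ⟨(T, s), ⟨hT, hs, hsT⟩, rfl⟩) ?_
    simp only [sub_mul, ite_mul, one_mul, zero_mul, Finset.sum_sub_distrib]
    rw [Finset.sum_ite_eq', if_pos hs, Finset.sum_ite_mem, Finset.inter_eq_right.mpr hT,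
      ← interp_apply, h0, sub_self]

theorem eventually_sub_mem_posCone {S : Finset V} {x y : V} (hx : x ∈ openCone S)
    (hy : y ∈ posCone S) : ∀ᶠ ε : ℝ in nhdsWithin 0 (Ioi 0), x - ε • y ∈ posCone S := by
  obtain ⟨u, hu, rfl⟩ := hx
  obtain ⟨w, hw, rfl⟩ := hy
  have h : ∀ s ∈ S, ∀ᶠ ε : ℝ in nhdsWithin 0 (Ioi 0), 0 < u s - ε * w s := by
    intro s hs
    have hc : Continuous fun ε : ℝ => u s - ε * w s := by fun_prop
    have ht := (hc.tendsto 0).mono_left (nhdsWithin_le_nhds (s := Ioi 0))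
    exact ht.eventually_const_lt (by simpa using hu s hs)
  filter_upwards [(Filter.eventually_all_finset S).mpr h] with ε hε
  exact ⟨fun s => u s - ε * w s, fun s hs => (hε s hs).le, by
    simp [sub_smul, Finset.smul_sum, mul_smul]⟩

theorem mem_openCone_of_sub_mem {S : Finset V} {x y : V} (hy : y ∈ openCone S) {ε : ℝ}
    (hε : 0 < ε) (h : x - ε • y ∈ posCone S) : x ∈ openCone S := by
  have := add_mem_openCone (smul_mem_openCone hy hε) h
  rwa [add_sub_cancel] at this

/-- A numerical form of the symmetry of a polynomial `1 + a t + t²`. -/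
theorem sum_symm {ι : Type*} (I : Finset ι) (c : ι → ℤ) {N : ℤ → ℕ} (hN : ∀ j < 0, N j = 0)
    (hN0 : N 0 = 1) {d : ℤ} (hf : ∀ k < 0, ∑ i ∈ I, N (k - c i) = 0)
    (hf0 : ∑ i ∈ I, N (0 - c i) = 1) (hg : ∀ k < d, ∑ i ∈ I, N (k - (d + 2 - c i)) = 0)
    (hg0 : ∑ i ∈ I, N (d - (d + 2 - c i)) = 1) (k : ℤ) :
    ∑ i ∈ I, N (k + d - (d + 2 - c i)) = ∑ i ∈ I, N (k - c i) := by
  have h0 : ∀ i ∈ I, 0 ≤ c i := fun i hi => by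
    by_contra! hlt
    have := Finset.sum_eq_zero_iff.mp (hf _ hlt) i hi
    rw [sub_self, hN0] at this
    exact one_ne_zero this
  have h2 : ∀ i ∈ I, c i ≤ 2 := fun i hi => by
    by_contra! hlt
    have := Finset.sum_eq_zero_iff.mp (hg (d + 2 - c i) (by omega)) i hi
    rw [sub_self, hN0] at this
    exact one_ne_zero this
  have key : ∀ F : ℤ → ℕ, ∑ i ∈ I, F (c i) =
      F 0 + F 2 + F 1 * ∑ i ∈ I, if c i = 1 then 1 else 0 := by
    intro F
    have : ∀ i ∈ I, F (c i) = F 0 * N (0 - c i) + F 2 * N (d - (d + 2 - c i)) +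
        F 1 * if c i = 1 then 1 else 0 := by
      intro i hi
      have hc0 := h0 i hi
      have hc2 := h2 i hi
      obtain hc | hc | hc : c i = 0 ∨ c i = 1 ∨ c i = 2 := by omega
      · simp [hc, hN, hN0]
      · rw [hc, hN (0 - 1) (by omega), hN (d - (d + 2 - 1)) (by omega)]
        simp
      · simp [hc, hN, hN0]
    rw [Finset.sum_congr rfl this, Finset.sum_add_distrib, Finset.sum_add_distrib,
      ← Finset.mul_sum, ← Finset.mul_sum, ← Finset.mul_sum, hf0, hg0, mul_one, mul_one]
  rw [key (fun c => N (k - c)), key (fun c => N (k + d - (d + 2 - c)))]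
  rw [show k + d - (d + 2 - 0) = k - 2 by ring, show k + d - (d + 2 - 2) = k - 0 by ring,
    show k + d - (d + 2 - 1) = k - 1 by ring]
  ring

theorem height_nonneg {S : Finset V} {h : V →ₗ[ℝ] ℝ} (hh : ∀ s ∈ S, h s = 1) {x : V}
    (hx : x ∈ posCone S) : 0 ≤ h x := by
  obtain ⟨u, hu, rfl⟩ := hx
  rw [map_sum]
  exact Finset.sum_nonneg fun s hs => by simpa [hh s hs] using hu s hs

theorem eq_zero_of_height {S : Finset V} {h : V →ₗ[ℝ] ℝ} (hh : ∀ s ∈ S, h s = 1) {x : V}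
    (hx : x ∈ posCone S) (h0 : h x = 0) : x = 0 := by
  obtain ⟨u, hu, rfl⟩ := hx
  rw [map_sum, Finset.sum_eq_zero_iff_of_nonneg
    fun s hs => by simpa [hh s hs] using hu s hs] at h0
  exact Finset.sum_eq_zero fun s hs => by
    have := h0 s hs
    rw [map_smul, hh s hs, smul_eq_mul, mul_one] at this
    rw [this, zero_smul]

/-- If the cone over `S` has a unique interior lattice point `m` of height `d`, where the dimension is
`d + 2`, then every interior lattice point is the sum of `m` and a lattice point of the cone. -/
theorem sub_mem_posCone {S : Finset V} {h : V →ₗ[ℝ] ℝ} {L : AddSubgroup V}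
    (hspan : Submodule.span ℝ (S : Set V) = ⊤) (hh : ∀ s ∈ S, h s = 1)
    (hint : ∀ x ∈ L, h x = (⌊h x⌋ : ℝ)) (hSL : ∀ s ∈ S, s ∈ L)
    (hfin : ∀ R : ℝ, {x | x ∈ L ∧ x ∈ posCone S ∧ h x ≤ R}.Finite) {d : ℕ}
    (hd : Module.finrank ℝ V = d + 2) {m : V} (hmL : m ∈ L) (hm : m ∈ openCone S)
    (hmh : h m = d) (huniq : ∀ x ∈ L, x ∈ openCone S → h x = d → x = m) {y : V} (hyL : y ∈ L)
    (hy : y ∈ openCone S) : y - m ∈ posCone S := by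
  classical
  obtain ⟨w, hw, hgen, hint'⟩ := exists_isGeneric S
  set q := ∑ s ∈ S, w s • s with hq
  have hqo : q ∈ openCone S := ⟨w, fun s _ => hw s, rfl⟩
  have hqc := openCone_subset_posCone S hqo
  have H : IsTriangulated S h L w := ⟨hspan, hh, hint, hSL, hfin, hint'⟩
  have hC : ∀ x, x ∈ posCone S ↔ ∃ T, IsLower S w T ∧ InCell T q x := fun x => by
    refine ⟨fun hx => H.exists_inCell hgen ?_, fun ⟨T, hT, hx⟩ =>
      mem_posCone_of_coord_nonneg hT.1 hT.2.1 fun s hs => (hx s hs).nonneg⟩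
    filter_upwards [self_mem_nhdsWithin] with ε hε
    exact add_mem_posCone hx (smul_mem_posCone hqc (le_of_lt hε))
  have hO : ∀ x, x ∈ openCone S ↔ ∃ T, IsLower S w T ∧ InCell T (-q) x := fun x => by
    refine ⟨fun hx => H.exists_inCell hgen.neg ?_, fun ⟨T, hT, hx⟩ => ?_⟩
    · filter_upwards [eventually_sub_mem_posCone hx hqc] with ε hε
      rwa [smul_neg, ← sub_eq_add_neg]
    · obtain ⟨ε, hε, hpos⟩ := ((eventually_mem_posCone_of_inCell hT.1 hT.2.1 hgen.neg hx).and
        self_mem_nhdsWithin).exists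
      rw [smul_neg, ← sub_eq_add_neg] at hε
      exact mem_openCone_of_sub_mem hqo hpos hε
  have hfC := H.ncard_eq_sum_boxes hgen hC
  have hfO : ∀ k : ℤ, {x | x ∈ L ∧ x ∈ openCone S ∧ h x = k}.ncard =
      ∑ i ∈ H.boxes q, numComps (d + 2) (k - ((d : ℤ) + 2 - ⌊h i.2⌋)) := fun k => by
    rw [H.ncard_eq_sum_boxes hgen.neg hO, H.sum_boxes_neg hgen
      (fun j => numComps (Module.finrank ℝ V) (k - j)), hd]
    push_cast
    rfl
  rw [hd] at hfC
  have hsymm := sum_symm (H.boxes q) (fun i => ⌊h i.2⌋) (N := numComps (d + 2)) (d := d)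
    (fun j hj => by simp [numComps, hj]) (by simp [numComps]) ?_ ?_ ?_ ?_
  · obtain ⟨k, hk⟩ : ∃ k : ℤ, h y = (k + d : ℤ) := ⟨⌊h y⌋ - d, by rw [hint y hyL]; simp⟩
    have hcard := hsymm k
    rw [← hfC, ← hfO] at hcard
    have hYfin : {x | x ∈ L ∧ x ∈ openCone S ∧ h x = (k + d : ℤ)}.Finite :=
      (hfin (k + d : ℤ)).subset fun x hx => ⟨hx.1, openCone_subset_posCone S hx.2.1, hx.2.2.le⟩
    have hsub : (fun x => m + x) '' {x | x ∈ L ∧ x ∈ posCone S ∧ h x = k} ⊆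
        {x | x ∈ L ∧ x ∈ openCone S ∧ h x = (k + d : ℤ)} := by
      rintro _ ⟨x, ⟨hxL, hx, hxk⟩, rfl⟩
      exact ⟨L.add_mem hmL hxL, add_mem_openCone hm hx, by
        rw [map_add, hmh, hxk]
        push_cast
        ring⟩
    have heq := Set.eq_of_subset_of_ncard_le hsub
      (by rw [Set.ncard_image_of_injective _ (add_right_injective m), hcard]) hYfin
    obtain ⟨x, hx, rfl⟩ : y ∈ (fun x => m + x) '' {x | x ∈ L ∧ x ∈ posCone S ∧ h x = k} := by
      rw [heq]
      exact ⟨hyL, hy, hk⟩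
    simpa using hx.2.1
  · intro k hk
    rw [← hfC, Set.ncard_eq_zero ((hfin k).subset fun x hx => ⟨hx.1, hx.2.1, hx.2.2.le⟩)]
    refine Set.eq_empty_of_forall_notMem fun x hx => ?_
    have h1 := height_nonneg hh hx.2.1
    rw [hx.2.2] at h1
    exact absurd (by exact_mod_cast h1) hk.not_ge
  · rw [← hfC, Set.ncard_eq_one]
    refine ⟨0, Set.eq_singleton_iff_unique_mem.mpr ⟨⟨L.zero_mem, ?_, by simp⟩, fun x hx =>
      eq_zero_of_height hh hx.2.1 (by simpa using hx.2.2)⟩⟩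
    exact ⟨0, by simp, by simp⟩
  · intro k hk
    rw [← hfO, Set.ncard_eq_zero ((hfin k).subset fun x hx =>
      ⟨hx.1, openCone_subset_posCone S hx.2.1, hx.2.2.le⟩)]
    refine Set.eq_empty_of_forall_notMem fun x ⟨hxL, hx, hxk⟩ => ?_
    obtain ⟨e, he⟩ : ∃ e : ℕ, (d : ℤ) = k + (e + 1 : ℕ) := ⟨(d - k - 1).toNat, by omega⟩
    have he' : (d : ℝ) = k + ((e + 1 : ℕ) : ℝ) := by exact_mod_cast he
    have hm' : ∀ s ∈ S, x + (e + 1) • s = m := fun s hs => by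
      refine huniq _ (L.add_mem hxL (L.nsmul_mem (hSL s hs) _)) ?_ ?_
      · rw [← Nat.cast_smul_eq_nsmul ℝ]
        exact add_mem_openCone hx (smul_mem_posCone (mem_posCone_of_mem hs) (by positivity))
      · rw [map_add, map_nsmul, hh s hs, hxk, he']
        simp
    have hcard : 1 < S.card := by
      have := finrank_span_finset_le_card (R := ℝ) S
      rw [Set.finrank, hspan, finrank_top, hd] at this
      omega
    obtain ⟨s, hs, s', hs', hne⟩ := Finset.one_lt_card.mp hcard
    have heq := add_left_cancel ((hm' s hs).trans (hm' s' hs').symm)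
    rw [← Nat.cast_smul_eq_nsmul ℝ, ← Nat.cast_smul_eq_nsmul ℝ] at heq
    exact hne (smul_right_injective V (by positivity : ((e + 1 : ℕ) : ℝ) ≠ 0) heq)
  · rw [← hfO, Set.ncard_eq_one]
    exact ⟨m, Set.eq_singleton_iff_unique_mem.mpr ⟨⟨hmL, hm, by simpa using hmh⟩, fun x hx =>
      huniq x hx.1 hx.2.1 (by simpa using hx.2.2)⟩⟩

end Cone

section Homogenize

variable {E : Type*} [NormedAddCommGroup E] [NormedSpace ℝ E]

open Classical in
/-- A finite set of points placed at height one. -/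
def homogenize (A : Finset E) : Finset (E × ℝ) := A.image fun x => (x, 1)

omit [NormedAddCommGroup E] [NormedSpace ℝ E] in
theorem mem_homogenize {A : Finset E} {z : E × ℝ} : z ∈ homogenize A ↔ z.1 ∈ A ∧ z.2 = 1 := by
  simp only [homogenize, Finset.mem_image]
  constructor
  · rintro ⟨x, hx, rfl⟩
    exact ⟨hx, rfl⟩
  · rintro ⟨h1, h2⟩
    exact ⟨z.1, h1, Prod.ext rfl h2.symm⟩

theorem sum_homogenize (A : Finset E) (u : E × ℝ → ℝ) :
    ∑ s ∈ homogenize A, u s • s = (∑ a ∈ A, u (a, 1) • a, ∑ a ∈ A, u (a, 1)) := by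
  classical
  unfold homogenize
  rw [Finset.sum_image fun x _ y _ h => congrArg Prod.fst h]
  ext <;> simp [Prod.fst_sum, Prod.snd_sum]

theorem prod_one_mem_posCone {A : Finset E} {x : E} (hx : x ∈ convexHull ℝ (A : Set E)) :
    (x, (1 : ℝ)) ∈ posCone (homogenize A) := by
  obtain ⟨w, hw, h1, h2⟩ := Finset.mem_convexHull'.mp hx
  exact ⟨fun z => w z.1, fun s hs => hw _ (mem_homogenize.mp hs).1, by
    rw [sum_homogenize, h1, h2]⟩

theorem exists_of_mem_posCone {A : Finset E} (hA : A.Nonempty) {z : E × ℝ}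
    (hz : z ∈ posCone (homogenize A)) :
    0 ≤ z.2 ∧ ∃ x ∈ convexHull ℝ (A : Set E), z.1 = z.2 • x := by
  obtain ⟨u, hu, rfl⟩ := hz
  rw [sum_homogenize]
  have hu' : ∀ a ∈ A, 0 ≤ u (a, 1) := fun a ha => hu _ (mem_homogenize.mpr ⟨ha, rfl⟩)
  have h0 := Finset.sum_nonneg hu'
  refine ⟨h0, ?_⟩
  rcases h0.eq_or_lt with h | h
  · obtain ⟨a, ha⟩ := hA
    refine ⟨a, subset_convexHull _ _ ha, ?_⟩
    dsimp only
    rw [← h, zero_smul]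
    exact Finset.sum_eq_zero fun b hb => by
      rw [(Finset.sum_eq_zero_iff_of_nonneg hu').mp h.symm b hb, zero_smul]
  · refine ⟨_, Finset.mem_convexHull'.mpr
      ⟨fun a => (∑ a ∈ A, u (a, 1))⁻¹ * u (a, 1), fun a ha => mul_nonneg (inv_nonneg.mpr h0)
        (hu' a ha), ?_, rfl⟩, ?_⟩
    · rw [← Finset.mul_sum, inv_mul_cancel₀ h.ne']
    · simp only [mul_smul, ← Finset.smul_sum]
      rw [smul_inv_smul₀ h.ne']

theorem eventually_add_smul_mem {P : Set E} {x : E} (hx : x ∈ interior P) (v : E) :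
    ∀ᶠ ε : ℝ in nhdsWithin 0 (Ioi 0), x + ε • v ∈ P := by
  have hc : Continuous fun ε : ℝ => x + ε • v := by fun_prop
  have ht := (hc.tendsto 0).mono_left (nhdsWithin_le_nhds (s := Ioi 0))
  rw [zero_smul, add_zero] at ht
  exact ht.eventually_mem (mem_interior_iff_mem_nhds.mp hx)

theorem prod_one_mem_openCone {A : Finset E} {x : E}
    (hx : x ∈ interior (convexHull ℝ (A : Set E))) : (x, (1 : ℝ)) ∈ openCone (homogenize A) := by
  have hA : A.Nonempty := by
    have := convexHull_nonempty_iff.mp ⟨x, interior_subset hx⟩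
    simpa using this
  have hb : ∑ s ∈ homogenize A, s ∈ openCone (homogenize A) := ⟨fun _ => 1, by simp, by simp⟩
  have hcard : (0 : ℝ) < A.card := by exact_mod_cast hA.card_pos
  set y : E × ℝ := (A.card : ℝ)⁻¹ • ∑ s ∈ homogenize A, s with hy
  have hyo : y ∈ openCone (homogenize A) := smul_mem_openCone hb (inv_pos.mpr hcard)
  have hy2 : y.2 = 1 := by
    have := sum_homogenize A fun _ => 1
    simp only [one_smul] at this
    rw [hy, this]
    simp [hcard.ne']
  obtain ⟨ε, hε, hpos⟩ := ((eventually_add_smul_mem hx (x - y.1)).and self_mem_nhdsWithin).exists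
  have hpos : (0 : ℝ) < ε := hpos
  have h := smul_mem_openCone (add_mem_openCone (smul_mem_openCone hyo hpos)
    (prod_one_mem_posCone hε)) (r := (1 + ε)⁻¹) (by positivity)
  convert! h using 1
  rw [eq_inv_smul_iff₀ (by positivity)]
  ext1
  · simp only [Prod.smul_mk, Prod.fst_add, Prod.smul_fst]
    module
  · simp [hy2, add_comm]

theorem exists_of_mem_openCone {A : Finset E} (hA : (interior (convexHull ℝ (A : Set E))).Nonempty)
    {z : E × ℝ} (hz : z ∈ openCone (homogenize A)) :
    0 < z.2 ∧ ∃ x ∈ interior (convexHull ℝ (A : Set E)), z.1 = z.2 • x := by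
  obtain ⟨x₀, hx₀⟩ := hA
  have hA' : A.Nonempty := by
    have := convexHull_nonempty_iff.mp ⟨x₀, interior_subset hx₀⟩
    simpa using this
  obtain ⟨ε, hε, hpos⟩ := ((eventually_sub_mem_posCone hz
    (prod_one_mem_posCone (interior_subset hx₀))).and self_mem_nhdsWithin).exists
  have hpos : (0 : ℝ) < ε := hpos
  obtain ⟨h0, x, hx, hzx⟩ := exists_of_mem_posCone hA' hε
  simp only [Prod.fst_sub, Prod.snd_sub, Prod.smul_fst, Prod.smul_snd, smul_eq_mul, mul_one] at h0 hzx
  have hz0 : 0 < z.2 := by linarith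
  refine ⟨hz0, (ε / z.2) • x₀ + ((z.2 - ε) / z.2) • x,
    (convex_convexHull ℝ _).combo_interior_self_mem_interior hx₀ hx (by positivity)
      (by positivity) (by field_simp; ring), ?_⟩
  rw [smul_add, smul_smul, smul_smul, mul_div_cancel₀ _ hz0.ne', mul_div_cancel₀ _ hz0.ne', ← hzx]
  abel

theorem span_homogenize {A : Finset E} (hA : affineSpan ℝ (convexHull ℝ (A : Set E)) = ⊤) :
    Submodule.span ℝ (homogenize A : Set (E × ℝ)) = ⊤ := by
  set W := Submodule.span ℝ (homogenize A : Set (E × ℝ)) with hW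
  let f : E →ᵃ[ℝ] E × ℝ := (AffineMap.id ℝ E).prod (AffineMap.const ℝ E 1)
  have h1 : ∀ x : E, (x, (1 : ℝ)) ∈ W := by
    have : affineSpan ℝ (A : Set E) ≤ W.toAffineSubspace.comap f := by
      rw [affineSpan_le]
      intro a ha
      exact Submodule.subset_span (Finset.mem_coe.mpr (mem_homogenize.mpr ⟨ha, rfl⟩))
    rw [affineSpan_convexHull] at hA
    rw [hA] at this
    exact fun x => this (AffineSubspace.mem_top ℝ E x)
  rw [eq_top_iff]
  rintro ⟨x, t⟩ -
  have : ((x, t) : E × ℝ) = (x, 1) + (t - 1) • (0, 1) := by ext <;> simp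
  rw [this]
  exact W.add_mem (h1 x) (W.smul_mem _ (h1 0))

end Homogenize

/-- The lattice points of `ℝⁿ × ℝ`. -/
def latProd (n : ℕ) : AddSubgroup ((Fin n → ℝ) × ℝ) where
  carrier := {z | z.1 ∈ lat n ∧ ∃ k : ℤ, z.2 = k}
  zero_mem' := ⟨fun _ => ⟨0, by simp⟩, 0, by simp⟩
  add_mem' := by
    rintro x y ⟨hx, k, hk⟩ ⟨hy, l, hl⟩
    refine ⟨fun i => ?_, k + l, by simp [hk, hl]⟩
    obtain ⟨a, ha⟩ := hx i
    obtain ⟨b, hb⟩ := hy i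
    exact ⟨a + b, by simp [ha, hb]⟩
  neg_mem' := by
    rintro x ⟨hx, k, hk⟩
    refine ⟨fun i => ?_, -k, by simp [hk]⟩
    obtain ⟨a, ha⟩ := hx i
    exact ⟨-a, by simp [ha]⟩

theorem finite_lat_inter {n : ℕ} {B : Set (Fin n → ℝ)} (hB : Bornology.IsBounded B) :
    (lat n ∩ B).Finite := by
  obtain ⟨R, hR⟩ := hB.subset_closedBall 0
  have hfin := (Set.finite_Icc (fun _ : Fin n => ⌊-R⌋) (fun _ => ⌈R⌉)).image
    fun m : Fin n → ℤ => fun i => (m i : ℝ)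
  refine hfin.subset fun x ⟨hx, hxB⟩ => ?_
  choose m hm using hx
  refine ⟨m, ⟨fun i => ?_, fun i => ?_⟩, funext fun i => (hm i).symm⟩
  all_goals
    have h1 : |x i| ≤ R := (norm_le_pi_norm x i).trans (by simpa using hR hxB)
    rw [hm i] at h1
  · exact Int.cast_le.mp ((Int.floor_le (-R)).trans (abs_le.mp h1).1)
  · exact Int.cast_le.mp ((abs_le.mp h1).2.trans (Int.le_ceil R))

theorem finite_latProd_inter {n : ℕ} {A : Finset (Fin n → ℝ)} (hA : A.Nonempty) (R : ℝ) :
    {z | z ∈ latProd n ∧ z ∈ posCone (homogenize A) ∧ LinearMap.snd ℝ (Fin n → ℝ) ℝ z ≤ R}.Finite := by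
  obtain ⟨M, hM⟩ := (isBounded_convexHull.mpr
    A.finite_toSet.isBounded : Bornology.IsBounded (convexHull ℝ (A : Set (Fin n → ℝ)))).exists_norm_le
  have h1 : (lat n ∩ Metric.closedBall 0 (R * M)).Finite :=
    finite_lat_inter Metric.isBounded_closedBall
  have h2 : ((fun k : ℤ => (k : ℝ)) '' Set.Icc 0 ⌈R⌉).Finite := (Set.finite_Icc _ _).image _
  refine (h1.prod h2).subset ?_
  rintro ⟨x, t⟩ ⟨⟨hx, k, rfl⟩, hc, hR⟩
  obtain ⟨h0, y, hy, hxy⟩ := exists_of_mem_posCone hA hc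
  dsimp only at h0 hxy hx
  simp only [LinearMap.snd_apply] at hR
  refine ⟨⟨hx, ?_⟩, k, ⟨by exact_mod_cast h0, Int.cast_le.mp (hR.trans (Int.le_ceil R))⟩, rfl⟩
  rw [mem_closedBall_zero_iff, hxy, norm_smul, Real.norm_of_nonneg h0]
  exact mul_le_mul hR (hM y hy) (norm_nonneg _) (h0.trans hR)

section ConeAt

variable {n : ℕ} {A : Finset (Fin n → ℝ)} {v y : Fin n → ℝ}

theorem exists_mem_posCone_of_mem_coneAt (hy : y ∈ coneAt n (convexHull ℝ (A : Set (Fin n → ℝ))) v) :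
    ∃ r : ℝ, (y + r • v, r) ∈ posCone (homogenize A) := by
  obtain ⟨r, hr, x, hx, rfl⟩ := hy
  refine ⟨r, ?_⟩
  convert! smul_mem_posCone (prod_one_mem_posCone hx) hr using 1
  ext1
  · simp [smul_sub]
  · simp

theorem mem_coneAt_of_mem_posCone (hA : A.Nonempty) {r : ℝ}
    (h : (y + r • v, r) ∈ posCone (homogenize A)) :
    y ∈ coneAt n (convexHull ℝ (A : Set (Fin n → ℝ))) v := by
  obtain ⟨h0, x, hx, hxy⟩ := exists_of_mem_posCone hA h
  exact ⟨r, h0, x, hx, by rw [smul_sub, ← hxy]; simp⟩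

theorem exists_mem_openCone_of_mem_interior
    (hA : (interior (convexHull ℝ (A : Set (Fin n → ℝ)))).Nonempty)
    (hv : v ∈ convexHull ℝ (A : Set (Fin n → ℝ)))
    (hy : y ∈ interior (coneAt n (convexHull ℝ (A : Set (Fin n → ℝ))) v)) :
    ∃ k : ℕ, (y + (k : ℝ) • v, (k : ℝ)) ∈ openCone (homogenize A) := by
  obtain ⟨x₀, hx₀⟩ := hA
  obtain ⟨ε, hε, hpos⟩ := ((eventually_add_smul_mem hy (v - x₀)).and self_mem_nhdsWithin).exists
  obtain ⟨r, hr⟩ := exists_mem_posCone_of_mem_coneAt hε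
  obtain ⟨k, hk⟩ := exists_nat_ge (ε + r)
  refine ⟨k, ?_⟩
  have h := add_mem_openCone (add_mem_openCone (smul_mem_openCone (prod_one_mem_openCone hx₀) hpos) hr)
    (smul_mem_posCone (prod_one_mem_posCone hv) (sub_nonneg.mpr hk))
  convert! h using 1
  ext1
  · simp only [Prod.smul_mk, Prod.fst_add]
    module
  · simp

theorem mem_interior_coneAt_of_mem_openCone
    (hA : (interior (convexHull ℝ (A : Set (Fin n → ℝ)))).Nonempty) {r : ℝ}
    (h : (y + r • v, r) ∈ openCone (homogenize A)) :
    y ∈ interior (coneAt n (convexHull ℝ (A : Set (Fin n → ℝ))) v) := by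
  obtain ⟨h0, x, hx, hxy⟩ := exists_of_mem_openCone hA h
  dsimp only at h0 hxy
  have hopen : IsOpen {z : Fin n → ℝ | v + r⁻¹ • z ∈ interior (convexHull ℝ (A : Set (Fin n → ℝ)))} :=
    isOpen_interior.preimage (by fun_prop)
  refine interior_maximal (fun z hz => ?_) hopen ?_
  · exact ⟨r, h0.le, v + r⁻¹ • z, interior_subset hz, by simp [h0.ne']⟩
  · have : y = r • (x - v) := by rw [smul_sub, ← hxy]; simp
    simpa [this, h0.ne'] using hx

end ConeAt

/-- For `n ≥ 4`, a lattice `n`-polytope `P` with exactly one lattice point in the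
interior of `(n-1)P` is Gorenstein. -/
theorem higher_dim_gorenstein (n : ℕ) (hn : 4 ≤ n) (P : Set (Fin n → ℝ))
    (hP : IsLatticePolytope n P)
    (hint : ∃ m₀, interior (dilate n (n - 1) P) ∩ lat n = {m₀}) :
    Gorenstein n P := by
  classical
  obtain ⟨⟨S₀, hS₀, hPS⟩, hspan⟩ := hP
  let A : Finset (Fin n → ℝ) := S₀.image fun m i => (m i : ℝ)
  have hPA : P = convexHull ℝ (A : Set (Fin n → ℝ)) := by rw [hPS, Finset.coe_image]
  have hAne : A.Nonempty := hS₀.image _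
  have hAlat : ∀ a ∈ A, a ∈ lat n := fun a ha => by
    obtain ⟨m, -, rfl⟩ := Finset.mem_image.mp ha
    exact fun i => ⟨m i, rfl⟩
  clear_value A
  subst hPA
  have hintne : (interior (convexHull ℝ (A : Set (Fin n → ℝ)))).Nonempty :=
    interior_convexHull_nonempty_iff_affineSpan_eq_top.mpr (by rwa [affineSpan_convexHull] at hspan)
  obtain ⟨d, rfl⟩ : ∃ d, n = d + 1 := ⟨n - 1, by omega⟩
  rw [Nat.add_sub_cancel] at hint
  have hd0 : (0 : ℝ) < d := by exact_mod_cast (by omega : 0 < d)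
  obtain ⟨m₀, hm₀⟩ := hint
  have hdil : interior (dilate (d + 1) d (convexHull ℝ (A : Set (Fin (d + 1) → ℝ)))) =
      (d : ℝ) • interior (convexHull ℝ (A : Set (Fin (d + 1) → ℝ))) :=
    interior_smul₀ hd0.ne' _
  rw [hdil] at hm₀
  have hm₀' := hm₀.symm ▸ Set.mem_singleton m₀
  have hopen : (m₀, (d : ℝ)) ∈ openCone (homogenize A) := by
    obtain ⟨x, hx, rfl⟩ := hm₀'.1
    simpa using smul_mem_openCone (prod_one_mem_openCone hx) hd0
  have key : ∀ z ∈ latProd (d + 1), z ∈ openCone (homogenize A) →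
      z - (m₀, (d : ℝ)) ∈ posCone (homogenize A) := by
    intro z hzL hz
    refine sub_mem_posCone (h := LinearMap.snd ℝ _ ℝ) (L := latProd (d + 1)) (d := d)
      (span_homogenize hspan) (fun s hs => (mem_homogenize.mp hs).2) ?_ (fun s hs => ?_)
      (finite_latProd_inter hAne) (by simp) ⟨hm₀'.2, d, by simp⟩ hopen rfl ?_ hzL hz
    · rintro x ⟨-, k, hk⟩
      simp [hk]
    · have hs' := mem_homogenize.mp hs
      exact ⟨hAlat _ hs'.1, 1, by simp [hs'.2]⟩
    · rintro ⟨x, t⟩ hxL hx hxd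
      obtain rfl : t = d := hxd
      obtain ⟨-, y, hy, hxy⟩ := exists_of_mem_openCone hintne hx
      have : x ∈ ({m₀} : Set (Fin (d + 1) → ℝ)) := hm₀ ▸ ⟨⟨y, hy, hxy.symm⟩, hxL.1⟩
      rw [Set.mem_singleton_iff.mp this]
  intro v hv
  have hvL : v ∈ lat (d + 1) := hAlat v (extremePoints_convexHull_subset hv)
  have hlat : ∀ {x y : Fin (d + 1) → ℝ} (c : ℤ), x ∈ lat (d + 1) → y ∈ lat (d + 1) →
      x + (c : ℝ) • y ∈ lat (d + 1) := fun {x y} c hx hy i => by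
    obtain ⟨a, ha⟩ := hx i
    obtain ⟨b, hb⟩ := hy i
    exact ⟨a + c * b, by simp [ha, hb]⟩
  have hmL : m₀ - (d : ℝ) • v ∈ lat (d + 1) := by
    simpa [sub_eq_add_neg] using hlat (-d) hm₀'.2 hvL
  refine ⟨m₀ - (d : ℝ) • v, ⟨mem_coneAt_of_mem_posCone hAne (r := d) ?_, hmL⟩, ?_⟩
  · simpa using openCone_subset_posCone _ hopen
  ext y
  constructor
  · rintro ⟨hy, hyL⟩
    obtain ⟨k, hk⟩ := exists_mem_openCone_of_mem_interior hintne hv.1 hy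
    have h := key _ ⟨by simpa using hlat k hyL hvL, k, by simp⟩ hk
    refine ⟨y - (m₀ - (d : ℝ) • v), ⟨mem_coneAt_of_mem_posCone hAne (r := k - d) ?_, ?_⟩,
      add_sub_cancel _ _⟩
    · convert! h using 1
      ext1
      · simp only [Prod.fst_sub]
        module
      · simp
    · rw [sub_eq_add_neg]
      simpa only [Int.cast_neg, Int.cast_one, neg_one_smul] using hlat (-1) hyL hmL
  · rintro ⟨c, ⟨hc, hcL⟩, rfl⟩
    obtain ⟨r, hr⟩ := exists_mem_posCone_of_mem_coneAt hc
    refine ⟨mem_interior_coneAt_of_mem_openCone hintne (r := d + r) ?_,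
      by simpa using hlat 1 hmL hcL⟩
    convert! add_mem_openCone hopen hr using 1
    ext1
    · simp only [Prod.fst_add]
      module
    · simp
end
end
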